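/- arXiv:2110.08686 — 3 statements merged into one kernel-verified Lean document; each statement's English description precedes it below -/
import Mathlib

section
/- Let S : ℝ ⇒ ℝⁿ be a smooth sweeping process with bounded values satisfying assumption (A1), and let a ∈ 𝒯. Suppose there exist b > a, ρ > 0 and a homeomorphism Ψ : [0,ρ] → [a,b], which is a C¹-diffeomorphism from (0,ρ) onto (a,b) with Ψ'(r) > 0 for all r ∈ (0,ρ), such that ‖D*(S∘Ψ)(r,x)|⁺ ≤ 1 for all r ∈ (0,ρ) and all x ∈ S(Ψ(r)). Then, setting σ := Ψ⁻¹ : [a,b] → [0,ρ] (an increasing continuous function with σ(a) = 0), for every a ≤ t₁ < t₂ ≤ b and every orbit γ ∈ AC(S,[t₁,t₂]) one has ℓ(γ) ≤ σ(t₂) − σ(t₁). -/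
open Set Metric Filter MeasureTheory
open scoped ENNReal RealInnerProductSpace Topology Pointwise

section Preliminaries

variable {E : Type*} [NormedAddCommGroup E] [InnerProductSpace ℝ E]

/-- The graph `𝒮 = {(t,x) : x ∈ S t}` of a multivalued map `S : ℝ ⇒ E`. -/
def sgraph (S : ℝ → Set E) : Set (ℝ × E) := {p | p.2 ∈ S p.1}

/-- The effective domain of a multivalued map. -/
def sdom (S : ℝ → Set E) : Set ℝ := {t | (S t).Nonempty}

/-- The euclidean pairing on `ℝ × E`. -/
def pinner (p q : ℝ × E) : ℝ := p.1 * q.1 + ⟪p.2, q.2⟫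

/-- Fréchet normal cone of a set `C ⊆ E` at `x`. -/
def frechetNC (C : Set E) (x : E) : Set E :=
  {v | ∀ ε : ℝ, 0 < ε → ∃ δ : ℝ, 0 < δ ∧
    ∀ y ∈ C, ‖y - x‖ < δ → ⟪v, y - x⟫ ≤ ε * ‖y - x‖}

/-- Limiting (Mordukhovich) normal cone of a set `C ⊆ E` at `x`. -/
def limitingNC (C : Set E) (x : E) : Set E :=
  {v | ∃ xs vs : ℕ → E, (∀ i, xs i ∈ C) ∧ (∀ i, vs i ∈ frechetNC C (xs i)) ∧
    Tendsto xs atTop (𝓝 x) ∧ Tendsto vs atTop (𝓝 v)}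

/-- Fréchet normal cone of a set `C ⊆ ℝ × E` at `z` (w.r.t. the euclidean pairing). -/
def frechetNCP (C : Set (ℝ × E)) (z : ℝ × E) : Set (ℝ × E) :=
  {v | ∀ ε : ℝ, 0 < ε → ∃ δ : ℝ, 0 < δ ∧
    ∀ y ∈ C, ‖y - z‖ < δ → pinner v (y - z) ≤ ε * ‖y - z‖}

/-- Limiting normal cone of a set `C ⊆ ℝ × E` at `z`. -/
def limitingNCP (C : Set (ℝ × E)) (z : ℝ × E) : Set (ℝ × E) :=
  {v | ∃ zs vs : ℕ → ℝ × E, (∀ i, zs i ∈ C) ∧ (∀ i, vs i ∈ frechetNCP C (zs i)) ∧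
    Tendsto zs atTop (𝓝 z) ∧ Tendsto vs atTop (𝓝 v)}

/-- The (limiting) coderivative `D*S(t,x)(u) = {a : (a,-u) ∈ N_𝒮(t,x)}`. -/
def coderiv (S : ℝ → Set E) (t : ℝ) (x : E) (u : E) : Set ℝ :=
  {a | (a, -u) ∈ limitingNCP (sgraph S) (t, x)}

/-- Asymmetric (oriented) modulus `‖D*S(t,x)|⁺ = sup {a⁺ : a ∈ D*S(t,x)(u), ‖u‖ ≤ 1}`
(with `sup ∅ = 0`). -/
noncomputable def asymMod (S : ℝ → Set E) (t : ℝ) (x : E) : ℝ≥0∞ :=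
  ⨆ (u : E) (_ : ‖u‖ ≤ 1) (a : ℝ) (_ : a ∈ coderiv S t x u), ENNReal.ofReal a

/-- Modulus `‖D*S(t,x)‖⁺ = sup {|a| : a ∈ D*S(t,x)(u), ‖u‖ ≤ 1}` (with `sup ∅ = 0`). -/
noncomputable def symMod (S : ℝ → Set E) (t : ℝ) (x : E) : ℝ≥0∞ :=
  ⨆ (u : E) (_ : ‖u‖ ≤ 1) (a : ℝ) (_ : a ∈ coderiv S t x u), ENNReal.ofReal |a|

/-- Oriented talweg function `φ↑(t) = sup_{x ∈ S(t)} ‖D*S(t,x)|⁺`. -/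
noncomputable def orientedTalweg (S : ℝ → Set E) (t : ℝ) : ℝ≥0∞ :=
  ⨆ x ∈ S t, asymMod S t x

/-- Talweg function `φ(t) = sup_{x ∈ S(t)} ‖D*S(t,x)‖⁺`. -/
noncomputable def talweg (S : ℝ → Set E) (t : ℝ) : ℝ≥0∞ :=
  ⨆ x ∈ S t, symMod S t x

/-- `M` is a `C¹`-submanifold of codimension `c` of `ℝ × E`: locally it is the zero set
of a `C¹` submersion into `ℝ^c`. -/
def IsC1SubmanifoldCodim (c : ℕ) (M : Set (ℝ × E)) : Prop :=
  ∀ z ∈ M, ∃ U : Set (ℝ × E), IsOpen U ∧ z ∈ U ∧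
    ∃ f : ℝ × E → EuclideanSpace ℝ (Fin c),
      ContDiffOn ℝ 1 f U ∧ (∀ y ∈ U, Function.Surjective ⇑(fderivWithin ℝ f U y)) ∧
      M ∩ U = {y ∈ U | f y = 0}

/-- Smooth sweeping process: the graph `𝒮` is closed, connected, and either a `C¹`
submanifold of dimension at most `dim E` (i.e. codimension at least one), or a
full-dimensional manifold with boundary whose boundary `∂𝒮` (the topological frontier)
is a `C¹` submanifold of codimension one. -/
def SmoothSweepingProcess (S : ℝ → Set E) : Prop :=
  IsClosed (sgraph S) ∧ IsConnected (sgraph S) ∧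
    ((∃ c : ℕ, 1 ≤ c ∧ IsC1SubmanifoldCodim c (sgraph S)) ∨
      (sgraph S = closure (interior (sgraph S)) ∧
        IsC1SubmanifoldCodim 1 (frontier (sgraph S))))

/-- The map `H_S(t) = ∂𝒮 ∩ ({t} × E)`. -/
def HSmap (S : ℝ → Set E) (t : ℝ) : Set (ℝ × E) :=
  frontier (sgraph S) ∩ {p : ℝ × E | p.1 = t}

/-- Continuity at `t₀` (relative to `I`) of a set-valued map for the Hausdorff–Pompeiu
metric. -/
def HPContinuousAt {X : Type*} [PseudoEMetricSpace X] (F : ℝ → Set X) (I : Set ℝ)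
    (t₀ : ℝ) : Prop :=
  ∀ ε : ℝ, 0 < ε → ∃ δ : ℝ, 0 < δ ∧ ∀ t ∈ I, |t - t₀| < δ →
    EMetric.hausdorffEdist (F t) (F t₀) < ENNReal.ofReal ε

/-- Continuity on `I` of a set-valued map for the Hausdorff–Pompeiu metric. -/
def HPContinuousOn {X : Type*} [PseudoEMetricSpace X] (F : ℝ → Set X) (I : Set ℝ) : Prop :=
  ∀ t₀ ∈ I, HPContinuousAt F I t₀

/-- `γ` is absolutely continuous on `J` (with some integrable a.e. derivative). -/
def AbsContOn (γ : ℝ → E) (J : Set ℝ) : Prop :=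
  ∃ g : ℝ → E, IntegrableOn g J ∧ ∀ s ∈ J, ∀ t ∈ J, γ t - γ s = ∫ u in s..t, g u

/-- `γ` is piecewise absolutely continuous on `I`: its discontinuities are contained in a
closed countable set `D`, and `γ` is absolutely continuous on each connected component of
`I \ D`. -/
def PiecewiseAC (γ : ℝ → E) (I : Set ℝ) : Prop :=
  ∃ D : Set ℝ, IsClosed D ∧ D.Countable ∧
    ∀ t ∈ I \ D, AbsContOn γ (connectedComponentIn (I \ D) t)

/-- `γ` (an absolutely continuous curve, with a.e. derivative `γ'`) is an orbit of the
sweeping process defined by `S` on the interval `I`:  `γ(t) ∈ S(t)` on `I` and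
`-γ̇(t) ∈ N_{S(t)}(γ(t))` for a.e. `t ∈ I`. -/
def ACOrbit (S : ℝ → Set E) (I : Set ℝ) (γ γ' : ℝ → E) : Prop :=
  (∀ t ∈ I, γ t ∈ S t) ∧ IntegrableOn γ' I ∧
    (∀ s ∈ I, ∀ t ∈ I, γ t - γ s = ∫ u in s..t, γ' u) ∧
    (∀ᵐ t ∂(volume.restrict I), -γ' t ∈ limitingNC (S t) (γ t))

/-- `γ` (with a.e. derivative `γ'`) is a piecewise absolutely continuous orbit of the
sweeping process defined by `S` on `I`. -/
def PACOrbit (S : ℝ → Set E) (I : Set ℝ) (γ γ' : ℝ → E) : Prop :=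
  ∃ D : Set ℝ, IsClosed D ∧ D.Countable ∧
    ∀ t ∈ I \ D, ACOrbit S (connectedComponentIn (I \ D) t) γ γ'

/-- Assumption (A1): from every point `(t,x) ∈ 𝒮` with `‖D*S(t,x)|⁺ < ∞` there issues an
orbit of the sweeping process. -/
def AssumptionA1 (S : ℝ → Set E) : Prop :=
  ∀ t : ℝ, ∀ x ∈ S t, asymMod S t x < ⊤ →
    ∃ δ : ℝ, 0 < δ ∧ ∃ γ γ' : ℝ → E, ACOrbit S (Ico t (t + δ)) γ γ' ∧ γ t = x

/-- Assumption (A2) at `tb`: the oriented talweg is finite just to the right of `tb`. -/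
def AssumptionA2At (S : ℝ → Set E) (tb : ℝ) : Prop :=
  ∃ δ : ℝ, 0 < δ ∧ ∀ t ∈ Ioo tb (tb + δ), orientedTalweg S t < ⊤

/-- Assumption (A3) at `tb`: `H_S` is Hausdorff–Pompeiu continuous just to the right
of `tb`. -/
def AssumptionA3At (S : ℝ → Set E) (tb : ℝ) : Prop :=
  ∃ δ : ℝ, 0 < δ ∧ HPContinuousOn (HSmap S) (Ioo tb (tb + δ))

/-- The set `𝒯` of points of the domain at which (A2) and (A3) hold. -/
def goodSet (S : ℝ → Set E) : Set ℝ :=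
  {t | t ∈ sdom S ∧ AssumptionA2At S t ∧ AssumptionA3At S t}

/-- `S` has bounded values. -/
def BoundedValues (S : ℝ → Set E) : Prop := ∀ t, Bornology.IsBounded (S t)

/-- A catching-up sequence `{(tᵢ,xᵢ)}_{i ≥ 0}` for `S`. -/
def CatchingUp (S : ℝ → Set E) (t : ℕ → ℝ) (x : ℕ → E) : Prop :=
  StrictMono t ∧ (∀ i, x i ∈ S (t i)) ∧
    ∀ i, dist (x i) (x (i + 1)) = infDist (x i) (S (t (i + 1)))

/-- A finite catching-up sequence `{(tᵢ,xᵢ)}_{i=0}^k` for `S`. -/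
def FiniteCatchingUp (S : ℝ → Set E) (k : ℕ) (t : ℕ → ℝ) (x : ℕ → E) : Prop :=
  (∀ i < k, t i < t (i + 1)) ∧ (∀ i ≤ k, x i ∈ S (t i)) ∧
    ∀ i < k, dist (x i) (x (i + 1)) = infDist (x i) (S (t (i + 1)))

/-- A piecewise catching-up sequence for `S`: blocks `{(tʲᵢ,Yʲᵢ)}_{i=0}^{k_j}`, each a
catching-up sequence, with `tʲ_{k_j} = tʲ⁺¹₀`. -/
def PiecewiseCatchingUp (S : ℝ → Set E) (k : ℕ → ℕ) (t : ℕ → ℕ → ℝ) (Y : ℕ → ℕ → E) : Prop :=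
  (∀ j, FiniteCatchingUp S (k j) (t j) (Y j)) ∧ ∀ j, t j (k j) = t (j + 1) 0

/-- Outer semicontinuity of `S` at `tb`. -/
def OuterSemicontinuousAt (S : ℝ → Set E) (tb : ℝ) : Prop :=
  ∀ (tk : ℕ → ℝ) (xk : ℕ → E) (x : E), (∀ k, xk k ∈ S (tk k)) →
    Tendsto tk atTop (𝓝 tb) → Tendsto xk atTop (𝓝 x) → x ∈ S tb

/-- Inner semicontinuity of `S` at `tb`. -/
def InnerSemicontinuousAt (S : ℝ → Set E) (tb : ℝ) : Prop :=
  ∀ x ∈ S tb, ∀ tk : ℕ → ℝ, (∀ k, tk k ∈ sdom S) → Tendsto tk atTop (𝓝 tb) →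
    Tendsto (fun k => infDist x (S (tk k))) atTop (𝓝 0)

/-- The oriented calm graphical modulus `calm↑S(t,x)`. -/
noncomputable def calmUp (S : ℝ → Set E) (t : ℝ) (x : E) : ℝ :=
  sInf {κ : ℝ | 0 < κ ∧ ∃ ε : ℝ, 0 < ε ∧ ∃ δ : ℝ, 0 < δ ∧
    ∀ t₁ ∈ Ioo t (t + ε), S t ∩ ball x δ ⊆ S t₁ + ball (0 : E) (κ * (t₁ - t))}

end Preliminaries

section Helpers

variable {E : Type*} [NormedAddCommGroup E] [InnerProductSpace ℝ E]

lemma pinner_w (w : E) (p : ℝ × E) :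
    pinner (‖w‖ ^ 2, -w) p = ⟪-w, p.2 - p.1 • w⟫ := by
  simp only [pinner, inner_sub_right, inner_smul_right, inner_neg_left,
    real_inner_self_eq_norm_sq]
  ring

lemma abs_pinner_le (v q : ℝ × E) : pinner v q ≤ (|v.1| + ‖v.2‖) * ‖q‖ := by
  have h1 : v.1 * q.1 ≤ |v.1| * ‖q‖ := by
    calc v.1 * q.1 ≤ |v.1 * q.1| := le_abs_self _
      _ = |v.1| * |q.1| := abs_mul _ _
      _ ≤ |v.1| * ‖q‖ := by
        gcongr
        exact norm_fst_le q
  have h2 : ⟪v.2, q.2⟫ ≤ ‖v.2‖ * ‖q‖ :=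
    (real_inner_le_norm _ _).trans (by gcongr; exact norm_snd_le q)
  unfold pinner
  linarith

lemma pinner_sub (v p q : ℝ × E) : pinner v (p - q) = pinner v p - pinner v q := by
  simp only [pinner, Prod.fst_sub, Prod.snd_sub, inner_sub_right]; ring

lemma pinner_smul (v p : ℝ × E) (c : ℝ) : pinner v (c • p) = c * pinner v p := by
  simp only [pinner, Prod.smul_fst, Prod.smul_snd, inner_smul_right, smul_eq_mul]; ring

lemma normal_limit {C : Set E} {x v h : E}
    (H : ∀ ε : ℝ, 0 < ε → ∀ᶠ y in 𝓝 x, y ∈ C → ∀ᶠ s in 𝓝[>] (0 : ℝ),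
      ∃ y' ∈ C, ‖y' - (y + s • h)‖ ≤ ε * s)
    (hv : v ∈ limitingNC C x) : ⟪v, h⟫ ≤ 0 := by
  obtain ⟨xs, vs, hxs, hvs, hx, hv⟩ := hv
  have key : ∀ ε : ℝ, 0 < ε → ε < 1 → ⟪v, h⟫ ≤ ε * (‖v‖ + ‖h‖ + 1) := by
    intro ε hε hε1
    have h1 : Tendsto (fun i => ⟪vs i, h⟫) atTop (𝓝 ⟪v, h⟫) := hv.inner tendsto_const_nhds
    have h2 : Tendsto (fun i => ε * (‖vs i‖ + ‖h‖ + 1)) atTop (𝓝 (ε * (‖v‖ + ‖h‖ + 1))) :=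
      ((hv.norm.add_const _).add_const _).const_mul _
    refine le_of_tendsto_of_tendsto h1 h2 ?_
    filter_upwards [hx.eventually (H ε hε)] with i hi
    obtain ⟨δ, hδ, hF⟩ := hvs i ε hε
    have hs : ∀ᶠ s in 𝓝[>] (0 : ℝ), s * (‖h‖ + 1) < δ := by
      have : Tendsto (fun s : ℝ => s * (‖h‖ + 1)) (𝓝 0) (𝓝 (0 * (‖h‖ + 1))) :=
        tendsto_id.mul_const _
      rw [zero_mul] at this
      exact (this.mono_left nhdsWithin_le_nhds).eventually (gt_mem_nhds hδ)
    obtain ⟨s, ⟨y', hy', hyn⟩, hsδ, hs0⟩ :=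
      ((hi (hxs i)).and (hs.and self_mem_nhdsWithin)).exists
    have hs0 : 0 < s := hs0
    have e : y' - xs i = (y' - (xs i + s • h)) + s • h := by abel
    have hn : ‖y' - xs i‖ ≤ s * (‖h‖ + 1) := by
      rw [e]
      refine (norm_add_le _ _).trans ?_
      rw [norm_smul, Real.norm_of_nonneg hs0.le]
      nlinarith
    have h3 := hF y' hy' (hn.trans_lt hsδ)
    have h4 : ⟪vs i, y' - xs i⟫ = ⟪vs i, y' - (xs i + s • h)⟫ + s * ⟪vs i, h⟫ := by
      rw [e, inner_add_right, inner_smul_right]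
    have h5 : -⟪vs i, y' - (xs i + s • h)⟫ ≤ ‖vs i‖ * (ε * s) := by
      have := abs_real_inner_le_norm (vs i) (y' - (xs i + s • h))
      have h6 := neg_abs_le ⟪vs i, y' - (xs i + s • h)⟫
      have h7 : ‖vs i‖ * ‖y' - (xs i + s • h)‖ ≤ ‖vs i‖ * (ε * s) := by gcongr
      linarith
    have h8 : s * ⟪vs i, h⟫ ≤ s * (ε * (‖vs i‖ + ‖h‖ + 1)) := by
      have : ε * ‖y' - xs i‖ ≤ ε * (s * (‖h‖ + 1)) := by gcongr
      nlinarith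
    exact le_of_mul_le_mul_left h8 hs0
  have lim : Tendsto (fun ε : ℝ => ε * (‖v‖ + ‖h‖ + 1)) (𝓝[>] 0) (𝓝 0) := by
    have : Tendsto (fun ε : ℝ => ε * (‖v‖ + ‖h‖ + 1)) (𝓝 0) (𝓝 (0 * (‖v‖ + ‖h‖ + 1))) :=
      tendsto_id.mul_const _
    rw [zero_mul] at this
    exact this.mono_left nhdsWithin_le_nhds
  refine ge_of_tendsto lim ?_
  filter_upwards [Ioo_mem_nhdsGT (zero_lt_one (α := ℝ))] with ε hε
  exact key ε hε.1 hε.2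

lemma tendsto_add_smul (y h : E) :
    Tendsto (fun s : ℝ => y + s • h) (𝓝[>] 0) (𝓝 y) := by
  have : ContinuousAt (fun s : ℝ => y + s • h) 0 := by fun_prop
  have h2 : Tendsto (fun s : ℝ => y + s • h) (𝓝 0) (𝓝 (y + (0 : ℝ) • h)) := this
  rw [zero_smul, add_zero] at h2
  exact h2.mono_left nhdsWithin_le_nhds

lemma interior_normal {C : Set E} {x v : E} (hC : C ∈ 𝓝 x) (hv : v ∈ limitingNC C x) :
    v = 0 := by
  have : ⟪v, v⟫ ≤ 0 := by
    refine normal_limit (fun ε hε => ?_) hv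
    filter_upwards [eventually_mem_nhds_iff.2 hC] with y hy _
    filter_upwards [(tendsto_add_smul y v).eventually hy, self_mem_nhdsWithin] with s hs hs0
    exact ⟨_, hs, by simpa using (mul_pos hε hs0).le⟩
  rw [real_inner_self_eq_norm_sq] at this
  exact norm_eq_zero.1 (pow_eq_zero_iff two_ne_zero |>.1 (le_antisymm this (sq_nonneg _)))

lemma strict_dir {F : Type*} [NormedAddCommGroup F] [NormedSpace ℝ F] {f : E → F}
    {f' : E →L[ℝ] F} {x : E} (hf : HasStrictFDerivAt f f' x) (h : E) {ε : ℝ} (hε : 0 < ε) :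
    ∀ᶠ y in 𝓝 x, ∀ᶠ s in 𝓝[>] (0 : ℝ), ‖f (y + s • h) - f y - s • f' h‖ ≤ ε * s := by
  have h1 : 0 < ε / (‖h‖ + 1) := by positivity
  have h2 := hf.isLittleO.def h1
  have h2' := (eventually_eventually_nhds.2 h2)
  have hd : Tendsto (fun y : E => (y, y)) (𝓝 x) (𝓝 (x, x)) :=
    (continuous_id.prodMk continuous_id).tendsto x
  filter_upwards [hd.eventually h2'] with y hy
  have h3 : Tendsto (fun s : ℝ => (y + s • h, y)) (𝓝[>] 0) (𝓝 (y, y)) :=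
    (tendsto_add_smul y h).prodMk_nhds tendsto_const_nhds
  filter_upwards [h3.eventually hy, self_mem_nhdsWithin] with s hs hs0
  have hs0 : 0 < s := hs0
  simp only [add_sub_cancel_left, map_smul, norm_smul, Real.norm_of_nonneg hs0.le] at hs
  refine hs.trans ?_
  rw [div_mul_eq_mul_div, div_le_iff₀ (by positivity)]
  nlinarith [norm_nonneg h, mul_pos hε hs0]

lemma metric_reg [CompleteSpace E] {F : Type*} [NormedAddCommGroup F] [NormedSpace ℝ F]
    [CompleteSpace F] {f : E → F}
    {f' : E →L[ℝ] F} {x : E} (hf : HasStrictFDerivAt f f' x) (hs : Function.Surjective f')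
    (hx : f x = 0) {C : Set E} (hC : ∀ᶠ y in 𝓝 x, f y = 0 → y ∈ C) :
    ∃ K : ℝ, 0 < K ∧ ∀ᶠ y in 𝓝 x, ∃ y' ∈ C, ‖y' - y‖ ≤ K * ‖f y‖ := by
  have hr : f'.range = ⊤ := LinearMap.range_eq_top.2 hs
  let R := f'.nonlinearRightInverseOfSurjective hr
  have Rpos : 0 < R.nnnorm := f'.nonlinearRightInverseOfSurjective_nnnorm_pos hr
  set c : NNReal := R.nnnorm⁻¹ / 2 with hc
  have cpos : 0 < c := by simp [hc, Rpos]
  obtain ⟨s, hsn, hA⟩ := hf.approximates_deriv_on_nhds (c := c) (Or.inr cpos)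
  have hcr : (0 : ℝ) < c := cpos
  have hce : ((R.nnnorm : ℝ)⁻¹ - c) = c := by
    rw [hc]; push_cast; ring
  obtain ⟨δ, hδ, hB⟩ := Metric.mem_nhds_iff.1 (inter_mem hsn hC)
  refine ⟨(c : ℝ)⁻¹, by positivity, ?_⟩
  have hlim : Tendsto (fun y => ‖y - x‖ + (c : ℝ)⁻¹ * ‖f y‖) (𝓝 x) (𝓝 0) := by
    have h1 : ContinuousAt (fun y => ‖y - x‖ + (c : ℝ)⁻¹ * ‖f y‖) x := by
      have := hf.continuousAt
      fun_prop
    have h2 : Tendsto (fun y => ‖y - x‖ + (c : ℝ)⁻¹ * ‖f y‖) (𝓝 x)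
      (𝓝 (‖x - x‖ + (c : ℝ)⁻¹ * ‖f x‖)) := h1
    simpa [hx] using h2
  filter_upwards [hlim.eventually (gt_mem_nhds hδ)] with y hy
  have hsub : closedBall y ((c : ℝ)⁻¹ * ‖f y‖) ⊆ ball x δ := by
    intro q hq
    rw [mem_closedBall, dist_eq_norm] at hq
    rw [mem_ball, dist_eq_norm]
    calc ‖q - x‖ = ‖(q - y) + (y - x)‖ := by congr 1; abel
      _ ≤ ‖q - y‖ + ‖y - x‖ := norm_add_le _ _
      _ < δ := by linarith
  have hsur := hA.surjOn_closedBall_of_nonlinearRightInverse R (ε := (c : ℝ)⁻¹ * ‖f y‖) (b := y)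
    (by positivity) (hsub.trans (hB.trans inter_subset_left))
  have h0 : (0 : F) ∈ closedBall (f y) (((R.nnnorm : ℝ)⁻¹ - c) * ((c : ℝ)⁻¹ * ‖f y‖)) := by
    rw [hce, mul_inv_cancel_left₀ hcr.ne', mem_closedBall, dist_eq_norm, zero_sub, norm_neg]
  obtain ⟨y', hy', hfy⟩ := hsur h0
  refine ⟨y', (hB (hsub hy')).2 hfy, ?_⟩
  rwa [mem_closedBall, dist_eq_norm] at hy'

lemma preconn_side {X : Type*} [TopologicalSpace X] {s t : Set X} (ht : IsPreconnected t)
    (hd : ∀ p ∈ t, p ∉ frontier s) {p q : X} (hp : p ∈ t) (hq : q ∈ t) (h : p ∈ s) : q ∈ s := by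
  have hsub : t ⊆ interior s ∪ interior sᶜ := by
    intro y hy
    by_contra hcon
    rw [mem_union, not_or, interior_compl, mem_compl_iff, not_not] at hcon
    exact hd y hy ⟨hcon.2, hcon.1⟩
  have hpi : p ∈ interior s := by
    by_contra hcon
    exact hd p hp ⟨subset_closure h, hcon⟩
  have hdis : Disjoint (interior s) (interior sᶜ) :=
    disjoint_compl_right.mono interior_subset interior_subset
  exact interior_subset (ht.subset_left_of_subset_union isOpen_interior isOpen_interior hdis hsub
    ⟨p, hp, hpi⟩ hq)

lemma one_side {V : Type*} [NormedAddCommGroup V] [NormedSpace ℝ V] {M : Set V} {z e : V}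
    {g : V → ℝ} {g' : V →L[ℝ] ℝ} (hg : HasStrictFDerivAt g g' z) (he : g' e = 1) (hz : g z = 0)
    (hfr : ∀ᶠ y in 𝓝 z, y ∈ frontier M → g y = 0) :
    ∃ q, ∀ᶠ y in 𝓝 z, 0 < g y → (y ∈ M ↔ q ∈ M) := by
  have hn := norm_nonneg e
  have hcpos : 0 < (1 / (2 * (‖e‖ + 1))) := by positivity
  obtain ⟨s, hsn, hA⟩ := hg.approximates_deriv_on_nhds
    (c := ⟨1 / (2 * (‖e‖ + 1)), hcpos.le⟩) (Or.inr hcpos)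
  obtain ⟨δ₀, hδ₀, hB⟩ := Metric.mem_nhds_iff.1 (inter_mem hsn hfr)
  obtain ⟨η, hη, hηe⟩ : ∃ η : ℝ, 0 < η ∧ η * ‖e‖ ≤ δ₀ / 2 := by
    refine ⟨δ₀ / (2 * (‖e‖ + 1)), by positivity, ?_⟩
    rw [div_mul_eq_mul_div, div_le_div_iff₀ (by positivity) (by norm_num)]
    nlinarith
  have hgc : ∀ᶠ y in 𝓝 z, -(η / 4) < g y := by
    have : Tendsto g (𝓝 z) (𝓝 0) := by
      have h := hg.continuousAt.tendsto
      rwa [hz] at h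
    exact this.eventually (lt_mem_nhds (by linarith))
  obtain ⟨δ₁, hδ₁, hB1⟩ := Metric.mem_nhds_iff.1 hgc
  set δ := min δ₁ (δ₀ / 2) with hδdef
  have hδ : 0 < δ := lt_min hδ₁ (by linarith)
  have hmem : ∀ y ∈ ball z δ, ∀ r ∈ Icc (0 : ℝ) η, y + r • e ∈ ball z δ₀ := by
    intro y hy r hr
    rw [mem_ball, dist_eq_norm] at hy ⊢
    have h1 : ‖y - z‖ < δ₀ / 2 := hy.trans_le (min_le_right _ _)
    calc ‖y + r • e - z‖ = ‖(y - z) + r • e‖ := by congr 1; abel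
      _ ≤ ‖y - z‖ + ‖r • e‖ := norm_add_le _ _
      _ < δ₀ / 2 + δ₀ / 2 := by
        rw [norm_smul, Real.norm_of_nonneg hr.1]
        have : r * ‖e‖ ≤ η * ‖e‖ := by gcongr; exact hr.2
        linarith
      _ = δ₀ := by ring
  have hinc : ∀ y ∈ ball z δ, ∀ r ∈ Icc (0 : ℝ) η, g y + r / 2 ≤ g (y + r • e) := by
    intro y hy r hr
    have hy0 : y ∈ ball z δ₀ := by
      have := hmem y hy 0 ⟨le_rfl, hη.le⟩
      simpa using this
    have h1 := hA _ (hB (hmem y hy r hr)).1 _ (hB hy0).1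
    simp only [add_sub_cancel_left, map_smul, he, smul_eq_mul, mul_one, norm_smul,
      Real.norm_of_nonneg hr.1, Real.norm_eq_abs] at h1
    have h2 := (abs_le.1 h1).1
    have h3 : 1 / (2 * (‖e‖ + 1)) * (r * ‖e‖) ≤ r / 2 := by
      rw [div_mul_eq_mul_div, div_le_div_iff₀ (by positivity) (by norm_num)]
      nlinarith [hr.1]
    change -(1 / (2 * (‖e‖ + 1)) * (r * ‖e‖)) ≤ _ at h2
    linarith
  have hnot : ∀ y ∈ ball z δ₀, 0 < g y → y ∉ frontier M := fun y hy hpos hf =>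
    hpos.ne' ((hB hy).2 hf)
  refine ⟨z + η • e, ?_⟩
  filter_upwards [ball_mem_nhds z hδ] with y hy hpos
  have hηm : η ∈ Icc (0 : ℝ) η := ⟨hη.le, le_rfl⟩
  have hseg : IsPreconnected ((fun r : ℝ => y + r • e) '' Icc 0 η) :=
    isPreconnected_Icc.image _ (by fun_prop)
  have hsegd : ∀ p ∈ (fun r : ℝ => y + r • e) '' Icc 0 η, p ∉ frontier M := by
    rintro _ ⟨r, hr, rfl⟩
    refine hnot _ (hmem y hy r hr) ?_
    have := hinc y hy r hr
    have := hr.1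
    linarith
  have m1 : y ∈ (fun r : ℝ => y + r • e) '' Icc 0 η := ⟨0, ⟨le_rfl, hη.le⟩, by simp⟩
  have m2 : y + η • e ∈ (fun r : ℝ => y + r • e) '' Icc 0 η := ⟨η, hηm, rfl⟩
  have hball : IsPreconnected (ball (z + η • e) δ) := (convex_ball _ _).isPreconnected
  have hballd : ∀ p ∈ ball (z + η • e) δ, p ∉ frontier M := by
    intro p hp
    have hp' : p - η • e ∈ ball z δ := by
      rw [mem_ball, dist_eq_norm] at hp ⊢
      convert hp using 2
      abel
    have e1 : p = (p - η • e) + η • e := by abel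
    rw [e1]
    refine hnot _ (hmem _ hp' η hηm) ?_
    have h1 := hinc _ hp' η hηm
    have h2 : -(η / 4) < g (p - η • e) := hB1 (ball_subset_ball (min_le_left _ _) hp')
    linarith
  have m3 : y + η • e ∈ ball (z + η • e) δ := by
    rw [mem_ball, dist_eq_norm] at hy ⊢
    convert hy using 2
    abel
  have m4 : z + η • e ∈ ball (z + η • e) δ := mem_ball_self hδ
  exact ⟨fun h => preconn_side hball hballd m3 m4 (preconn_side hseg hsegd m1 m2 h),
    fun h => preconn_side hseg hsegd m2 m1 (preconn_side hball hballd m4 m3 h)⟩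

lemma mem_frechetNCP_of_eventually {C : Set (ℝ × E)} {z v : ℝ × E}
    (h : ∀ ε : ℝ, 0 < ε → ∀ᶠ y in 𝓝 z, y ∈ C → pinner v (y - z) ≤ ε * ‖y - z‖) :
    v ∈ frechetNCP C z := by
  intro ε hε
  obtain ⟨δ, hδ, hB⟩ := Metric.eventually_nhds_iff.1 (h ε hε)
  exact ⟨δ, hδ, fun y hy hn => hB (by rwa [dist_eq_norm]) hy⟩

lemma slice_strict {F : Type*} [NormedAddCommGroup F] [NormedSpace ℝ F] {f : ℝ × E → F}
    {f' : ℝ × E →L[ℝ] F} {t : ℝ} {x : E} (hf : HasStrictFDerivAt f f' (t, x)) :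
    HasStrictFDerivAt (fun y => f (t, y)) (f'.comp (ContinuousLinearMap.inr ℝ ℝ E)) x := by
  have h2 : HasStrictFDerivAt (fun y : E => (t, y)) (ContinuousLinearMap.inr ℝ ℝ E) x :=
    (hasStrictFDerivAt_const t x).prodMk (hasStrictFDerivAt_id x)
  exact HasStrictFDerivAt.comp (g := f) x hf h2

lemma tendsto_slice (t : ℝ) (x : E) : Tendsto (fun y : E => (t, y)) (𝓝 x) (𝓝 (t, x)) :=
  (Continuous.prodMk_right t).tendsto x

lemma deriv_split {F : Type*} [NormedAddCommGroup F] [NormedSpace ℝ F]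
    {f' : ℝ × E →L[ℝ] F} {w : E} (h0 : f' (1, w) = 0) (p : ℝ × E) :
    f' (0, p.2 - p.1 • w) = f' p := by
  have e1 : ((0 : ℝ), p.2 - p.1 • w) = p - p.1 • ((1 : ℝ), w) := by
    ext <;> simp
  rw [e1, map_sub, map_smul, h0, smul_zero, sub_zero]

lemma caseA [FiniteDimensional ℝ E] {F : Type*} [NormedAddCommGroup F] [NormedSpace ℝ F]
    [CompleteSpace F] {S : ℝ → Set E} {t : ℝ} {γ : ℝ → E} {w : E}
    {f : ℝ × E → F} {f' : ℝ × E →L[ℝ] F} (hf : HasStrictFDerivAt f f' (t, γ t))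
    (hsurj : Function.Surjective f') 
    (hC : ∀ᶠ p in 𝓝 (t, γ t), p ∈ sgraph S ↔ f p = 0) (hγ : HasDerivAt γ w t)
    (hmem : ∀ᶠ s in 𝓝 t, γ s ∈ S s) (hn : -w ∈ limitingNC (S t) (γ t)) :
    (‖w‖ ^ 2, -w) ∈ frechetNCP (sgraph S) (t, γ t) := by
  have : CompleteSpace E := FiniteDimensional.complete ℝ E
  have hc : HasDerivAt (fun s => (s, γ s)) ((1 : ℝ), w) t := (hasDerivAt_id t).prodMk hγ
  have hfz : f (t, γ t) = 0 := hC.self_of_nhds.1 hmem.self_of_nhds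
  have hcc : Tendsto (fun s => (s, γ s)) (𝓝 t) (𝓝 (t, γ t)) := hc.continuousAt
  have h0 : f' (1, w) = 0 := by
    have h1 : HasDerivAt (fun s => f (s, γ s)) (f' (1, w)) t :=
      HasFDerivAt.comp_hasDerivAt (l := f) t hf.hasFDerivAt hc
    have h2 : (fun s => f (s, γ s)) =ᶠ[𝓝 t] fun _ => (0 : F) := by
      filter_upwards [hcc.eventually hC, hmem] with s hs hs2
      exact hs.1 hs2
    exact h1.unique ((hasDerivAt_const t (0 : F)).congr_of_eventuallyEq h2)
  have hsl := slice_strict hf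
  set D := f'.comp (ContinuousLinearMap.inr ℝ ℝ E) with hD
  have hDsurj : Function.Surjective D := by
    intro q
    obtain ⟨p, rfl⟩ := hsurj q
    exact ⟨p.2 - p.1 • w, deriv_split h0 p⟩
  have hCs : ∀ᶠ y in 𝓝 (γ t), y ∈ S t ↔ f (t, y) = 0 := (tendsto_slice t (γ t)).eventually hC
  obtain ⟨K, hK, hreg⟩ := metric_reg hsl hDsurj hfz (hCs.mono fun y hy => hy.2)
  have hker : ∀ h, D h = 0 → ⟪-w, h⟫ ≤ 0 := by
    intro h hh
    refine normal_limit (fun ε hε => ?_) hn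
    filter_upwards [strict_dir hsl h (div_pos hε hK), hCs, hreg.eventually_nhds]
      with y hy hyC hyr hyS
    filter_upwards [hy, (tendsto_add_smul y h).eventually hyr] with s hs1 hs2
    obtain ⟨y', hy', hb⟩ := hs2
    refine ⟨y', hy', hb.trans ?_⟩
    rw [hyC.1 hyS, hh, smul_zero, sub_zero, sub_zero] at hs1
    calc K * ‖f (t, y + s • h)‖ ≤ K * (ε / K * s) := by gcongr
      _ = ε * s := by field_simp
  have hpk : ∀ p : ℝ × E, f' p = 0 → pinner (‖w‖ ^ 2, -w) p ≤ 0 := by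
    intro p hp
    rw [pinner_w]
    apply hker
    rw [← hp]
    exact deriv_split h0 p
  have hr : f'.range = ⊤ := LinearMap.range_eq_top.2 hsurj
  let R := f'.nonlinearRightInverseOfSurjective hr
  set v : ℝ × E := (‖w‖ ^ 2, -w) with hv
  set M := |v.1| + ‖v.2‖ with hM
  have hM0 : 0 ≤ M := by positivity
  have hR0 : (0 : ℝ) ≤ R.nnnorm := R.nnnorm.2
  apply mem_frechetNCP_of_eventually
  intro ε hε
  have hpos : 0 < ε / (M * R.nnnorm + 1) := by positivity
  filter_upwards [hC, hf.hasFDerivAt.isLittleO.def hpos] with y hy hyo hyS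
  rw [hy.1 hyS, hfz, sub_zero, zero_sub, norm_neg] at hyo
  have h1 : pinner v (y - (t, γ t) - R (f' (y - (t, γ t)))) ≤ 0 := by
    apply hpk
    rw [map_sub, R.right_inv, sub_self]
  rw [pinner_sub] at h1
  have h2 := abs_pinner_le v (R (f' (y - (t, γ t))))
  have h3 : ‖R (f' (y - (t, γ t)))‖ ≤ R.nnnorm * ‖f' (y - (t, γ t))‖ := R.bound _
  calc pinner v (y - (t, γ t)) ≤ M * ‖R (f' (y - (t, γ t)))‖ := by linarith
    _ ≤ M * (R.nnnorm * (ε / (M * R.nnnorm + 1) * ‖y - (t, γ t)‖)) := by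
      gcongr; exact h3.trans (by gcongr)
    _ = (M * R.nnnorm / (M * R.nnnorm + 1)) * (ε * ‖y - (t, γ t)‖) := by ring
    _ ≤ 1 * (ε * ‖y - (t, γ t)‖) := by
      gcongr
      rw [div_le_one (by positivity)]; linarith
    _ = _ := one_mul _

lemma caseB {S : ℝ → Set E} {t : ℝ} {γ : ℝ → E} {w : E}
    {f : ℝ × E → ℝ} {f' : ℝ × E →L[ℝ] ℝ} (hf : HasStrictFDerivAt f f' (t, γ t))
    {e : ℝ × E} (he : f' e = 1) (hfz : f (t, γ t) = 0)
    (hC : ∀ᶠ p in 𝓝 (t, γ t), p ∈ sgraph S ↔ f p ≤ 0) (hγ : HasDerivAt γ w t)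
    (hmem : ∀ᶠ s in 𝓝 t, γ s ∈ S s) (hn : -w ∈ limitingNC (S t) (γ t)) :
    (‖w‖ ^ 2, -w) ∈ frechetNCP (sgraph S) (t, γ t) := by
  have hc : HasDerivAt (fun s => (s, γ s)) ((1 : ℝ), w) t := (hasDerivAt_id t).prodMk hγ
  have hcc : Tendsto (fun s => (s, γ s)) (𝓝 t) (𝓝 (t, γ t)) := hc.continuousAt
  have h0 : f' (1, w) = 0 := by
    have h1 : HasDerivAt (fun s => f (s, γ s)) (f' (1, w)) t :=
      HasFDerivAt.comp_hasDerivAt (l := f) t hf.hasFDerivAt hc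
    have h2 : IsLocalMax (fun s => f (s, γ s)) t := by
      filter_upwards [hcc.eventually hC, hmem] with s hs hs2
      rw [hfz]
      exact hs.1 hs2
    exact h2.hasDerivAt_eq_zero h1
  have hsl := slice_strict hf
  set D := f'.comp (ContinuousLinearMap.inr ℝ ℝ E) with hD
  have hCs : ∀ᶠ y in 𝓝 (γ t), y ∈ S t ↔ f (t, y) ≤ 0 := (tendsto_slice t (γ t)).eventually hC
  have hker : ∀ h, D h < 0 → ⟪-w, h⟫ ≤ 0 := by
    intro h hh
    refine normal_limit (fun ε hε => ?_) hn
    filter_upwards [strict_dir hsl h (neg_pos.2 hh), hCs, hCs.eventually_nhds]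
      with y hy hyC hyr hyS
    filter_upwards [hy, (tendsto_add_smul y h).eventually hyr, self_mem_nhdsWithin]
      with s hs1 hs2 hs0
    have hs0 : 0 < s := hs0
    refine ⟨_, hs2.2 ?_, by simpa using (mul_pos hε hs0).le⟩
    have := (abs_le.1 hs1).2
    have := hyC.1 hyS
    rw [smul_eq_mul] at *
    linarith
  have hpk : ∀ p : ℝ × E, f' p < 0 → pinner (‖w‖ ^ 2, -w) p ≤ 0 := by
    intro p hp
    rw [pinner_w]
    apply hker
    rw [← deriv_split h0 p] at hp
    exact hp
  set v : ℝ × E := (‖w‖ ^ 2, -w) with hv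
  set M := |pinner v e| with hM
  have hM0 : 0 ≤ M := abs_nonneg _
  apply mem_frechetNCP_of_eventually
  intro ε hε
  have hpos : 0 < ε / (2 * (M + 1)) := by positivity
  filter_upwards [hC, hf.hasFDerivAt.isLittleO.def hpos] with y hy hyo hyS
  have hy0 := hy.1 hyS
  rw [hfz, sub_zero, Real.norm_eq_abs] at hyo
  have h1 := (abs_le.1 hyo).1
  set q := y - (t, γ t) with hq
  set k := ε / (2 * (M + 1)) with hk
  rcases eq_or_ne q 0 with h00 | hq0
  · rw [h00]; simp [pinner]
  have hqn : 0 < ‖q‖ := norm_pos_iff.2 hq0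
  have h2 : pinner v (q - (2 * k * ‖q‖) • e) ≤ 0 := by
    apply hpk
    rw [map_sub, map_smul, he, smul_eq_mul, mul_one]
    nlinarith [mul_pos hpos hqn]
  rw [pinner_sub, pinner_smul] at h2
  have h3 : pinner v e ≤ M := le_abs_self _
  calc pinner v q ≤ 2 * k * ‖q‖ * pinner v e := by linarith
    _ ≤ 2 * k * ‖q‖ * (M + 1) := by gcongr; linarith
    _ = ε * ‖q‖ := by rw [hk]; field_simp

lemma key_normal [FiniteDimensional ℝ E] {S : ℝ → Set E} (hS : SmoothSweepingProcess S)
    {t : ℝ} {γ : ℝ → E} {w : E} (hγ : HasDerivAt γ w t)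
    (hmem : ∀ᶠ s in 𝓝 t, γ s ∈ S s) (hn : -w ∈ limitingNC (S t) (γ t)) :
    (‖w‖ ^ 2, -w) ∈ frechetNCP (sgraph S) (t, γ t) := by
  obtain ⟨hcl, -, ⟨c, -, hM⟩ | ⟨hci, hM⟩⟩ := hS
  · have hz : (t, γ t) ∈ sgraph S := hmem.self_of_nhds
    obtain ⟨U, hU, hzU, f, hf, hsurj, heq⟩ := hM _ hz
    have hst := (hf.contDiffAt (hU.mem_nhds hzU)).hasStrictFDerivAt one_ne_zero
    have hs := hsurj _ hzU
    rw [fderivWithin_of_isOpen hU hzU] at hs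
    refine caseA hst hs ?_ hγ hmem hn
    filter_upwards [hU.mem_nhds hzU] with p hp
    have := Set.ext_iff.1 heq p
    simp only [mem_inter_iff, mem_setOf_eq, hp, and_true, true_and] at this
    exact this
  · have hz : (t, γ t) ∈ sgraph S := hmem.self_of_nhds
    by_cases hint : (t, γ t) ∈ interior (sgraph S)
    · have h1 : S t ∈ 𝓝 (γ t) :=
        (tendsto_slice t (γ t)).eventually (mem_interior_iff_mem_nhds.1 hint)
      have h2 : w = 0 := neg_eq_zero.1 (interior_normal h1 hn)
      intro ε hε
      refine ⟨1, one_pos, fun y _ _ => ?_⟩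
      have : pinner (‖w‖ ^ 2, -w) (y - (t, γ t)) = 0 := by simp [h2, pinner]
      rw [this]
      positivity
    have hzf : (t, γ t) ∈ frontier (sgraph S) := ⟨subset_closure hz, hint⟩
    obtain ⟨U, hU, hzU, f, hf, hsurj, heq⟩ := hM _ hzf
    have hst := (hf.contDiffAt (hU.mem_nhds hzU)).hasStrictFDerivAt one_ne_zero
    have hs := hsurj _ hzU
    rw [fderivWithin_of_isOpen hU hzU] at hs
    set P : EuclideanSpace ℝ (Fin 1) →L[ℝ] ℝ := EuclideanSpace.proj 0 with hP
    have hP0 : ∀ q : EuclideanSpace ℝ (Fin 1), q = 0 ↔ P q = 0 := by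
      intro q
      constructor
      · rintro rfl; simp
      · intro h
        ext i
        fin_cases i
        simpa [hP] using h
    set g : ℝ × E → ℝ := fun y => P (f y) with hg
    set g' := P.comp (fderiv ℝ f (t, γ t)) with hg'
    have hgs : HasStrictFDerivAt g g' (t, γ t) := P.hasStrictFDerivAt.comp (t, γ t) hst
    obtain ⟨e, he⟩ := hs (EuclideanSpace.single 0 1)
    have he1 : g' e = 1 := by simp [hg', he, hP]
    have hfr : ∀ᶠ y in 𝓝 (t, γ t), y ∈ frontier (sgraph S) ↔ g y = 0 := by
      filter_upwards [hU.mem_nhds hzU] with p hp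
      have := Set.ext_iff.1 heq p
      simp only [mem_inter_iff, mem_setOf_eq, hp, and_true, true_and] at this
      rw [this, hP0]
    have hgz : g (t, γ t) = 0 := hfr.self_of_nhds.1 hzf
    have hngs : HasStrictFDerivAt (fun y => - g y) (-g') (t, γ t) := hgs.neg
    have hne : (-g') (-e) = 1 := by simp [he1]
    have hngz : - g (t, γ t) = 0 := by rw [hgz, neg_zero]
    obtain ⟨q₁, h1⟩ := one_side hgs he1 hgz (hfr.mono fun y hy => hy.1)
    obtain ⟨q₂, h2⟩ := one_side (M := sgraph S) hngs hne hngz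
      (hfr.mono fun y hy h => by rw [hy.1 h, neg_zero])
    have hfrS : ∀ᶠ y in 𝓝 (t, γ t), g y = 0 → y ∈ sgraph S := by
      filter_upwards [hfr] with y hy h
      exact hcl.frontier_subset (hy.2 h)
    by_cases c1 : q₁ ∈ sgraph S <;> by_cases c2 : q₂ ∈ sgraph S
    · exfalso
      apply hint
      rw [mem_interior_iff_mem_nhds]
      filter_upwards [h1, h2, hfrS] with y a1 a2 a3
      rcases lt_trichotomy (g y) 0 with h | h | h
      · exact (a2 (by linarith)).2 c2
      · exact a3 h
      · exact (a1 h).2 c1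
    · refine caseB hngs hne hngz ?_ hγ hmem hn
      filter_upwards [h1, h2, hfrS] with y a1 a2 a3
      rcases lt_trichotomy (g y) 0 with h | h | h
      · have := (a2 (by linarith))
        exact ⟨fun hh => absurd (this.1 hh) c2, fun hh => by linarith⟩
      · exact ⟨fun _ => by linarith, fun _ => a3 h⟩
      · exact ⟨fun _ => by linarith, fun _ => (a1 h).2 c1⟩
    · refine caseB hgs he1 hgz ?_ hγ hmem hn
      filter_upwards [h1, h2, hfrS] with y a1 a2 a3
      rcases lt_trichotomy (g y) 0 with h | h | h
      · exact ⟨fun _ => by linarith, fun _ => (a2 (by linarith)).2 c2⟩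
      · exact ⟨fun _ => by linarith, fun _ => a3 h⟩
      · exact ⟨fun hh => absurd ((a1 h).1 hh) c1, fun hh => by linarith⟩
    · exfalso
      rw [hci, mem_closure_iff_frequently] at hz
      obtain ⟨y, hyi, a1, a2, a3⟩ := (hz.and_eventually (h1.and (h2.and hfr))).exists
      have hyS := interior_subset hyi
      rcases lt_trichotomy (g y) 0 with h | h | h
      · exact c2 ((a2 (by linarith)).1 hyS)
      · exact (a3.2 h).2 hyi
      · exact c1 ((a1 h).1 hyS)

lemma transfer {S : ℝ → Set E} {Ψ : ℝ → ℝ} {r d α : ℝ} {x u : E} (hΨ : HasDerivAt Ψ d r)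
    (h : (α, u) ∈ frechetNCP (sgraph S) (Ψ r, x)) :
    (α * d, u) ∈ frechetNCP (sgraph (fun s => S (Ψ s))) (r, x) := by
  apply mem_frechetNCP_of_eventually
  intro ε hε
  have hε1 : 0 < ε / (2 * (|d| + 2)) := by positivity
  have hε2 : 0 < ε / (2 * (|α| + 1)) := by positivity
  obtain ⟨δ, hδ, hF⟩ := h _ hε1
  have hfst : Tendsto (fun p : ℝ × E => p.1) (𝓝 (r, x)) (𝓝 r) := continuous_fst.tendsto _
  have ho : ∀ k : ℝ, 0 < k → ∀ᶠ p : ℝ × E in 𝓝 (r, x),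
      |Ψ p.1 - Ψ r - (p.1 - r) * d| ≤ k * |p.1 - r| := by
    intro k hk
    have := hΨ.isLittleO.def hk
    simpa using hfst.eventually this
  have hcont : Tendsto (fun p : ℝ × E => ‖(Ψ p.1, p.2) - (Ψ r, x)‖) (𝓝 (r, x)) (𝓝 0) := by
    have h1 : Tendsto (fun p : ℝ × E => (Ψ p.1, p.2)) (𝓝 (r, x)) (𝓝 (Ψ r, x)) :=
      (hΨ.continuousAt.tendsto.comp hfst).prodMk_nhds (continuous_snd.tendsto _)
    exact tendsto_iff_norm_sub_tendsto_zero.1 h1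
  filter_upwards [ho 1 one_pos, ho _ hε2, hcont.eventually (gt_mem_nhds hδ)] with p o1 o2 hp hpS
  have h1 := hF (Ψ p.1, p.2) hpS hp
  have nf : |p.1 - r| ≤ ‖p - (r, x)‖ := norm_fst_le (p - (r, x))
  have ns : ‖p.2 - x‖ ≤ ‖p - (r, x)‖ := norm_snd_le (p - (r, x))
  set N := ‖p - (r, x)‖ with hN
  have hN0 : 0 ≤ N := norm_nonneg _
  have hΨn : |Ψ p.1 - Ψ r| ≤ (|d| + 2) * N := by
    have e1 : Ψ p.1 - Ψ r = (Ψ p.1 - Ψ r - (p.1 - r) * d) + (p.1 - r) * d := by ring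
    rw [e1]
    refine (abs_add_le _ _).trans ?_
    rw [abs_mul]
    have : |p.1 - r| * |d| ≤ N * |d| := by gcongr
    nlinarith
  have hnn : ‖(Ψ p.1, p.2) - (Ψ r, x)‖ ≤ (|d| + 2) * N := by
    rw [Prod.norm_def]
    refine max_le hΨn (ns.trans ?_)
    nlinarith [abs_nonneg d]
  have h2 : ε / (2 * (|d| + 2)) * ‖(Ψ p.1, p.2) - (Ψ r, x)‖ ≤ ε / 2 * N := by
    calc _ ≤ ε / (2 * (|d| + 2)) * ((|d| + 2) * N) := by gcongr
      _ = ε / 2 * N := by field_simp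
  have h3 : -(α * (Ψ p.1 - Ψ r - (p.1 - r) * d)) ≤ ε / 2 * N := by
    calc _ ≤ |α * (Ψ p.1 - Ψ r - (p.1 - r) * d)| := neg_le_abs _
      _ = |α| * |Ψ p.1 - Ψ r - (p.1 - r) * d| := abs_mul _ _
      _ ≤ (|α| + 1) * (ε / (2 * (|α| + 1)) * N) := by
        gcongr
        · linarith
        · exact o2.trans (by gcongr)
      _ = ε / 2 * N := by field_simp
  simp only [pinner, Prod.fst_sub, Prod.snd_sub] at h1 ⊢
  nlinarith

lemma frechetNCP_smul {C : Set (ℝ × E)} {z v : ℝ × E} {c : ℝ} (hc : 0 < c)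
    (hv : v ∈ frechetNCP C z) : c • v ∈ frechetNCP C z := by
  intro ε hε
  obtain ⟨δ, hδ, h⟩ := hv (ε / c) (by positivity)
  refine ⟨δ, hδ, fun y hy hn => ?_⟩
  have h1 := h y hy hn
  have h2 : pinner (c • v) (y - z) = c * pinner v (y - z) := by
    simp only [pinner, Prod.smul_fst, Prod.smul_snd, inner_smul_left, smul_eq_mul]
    simp; ring
  rw [h2]
  calc c * pinner v (y - z) ≤ c * (ε / c * ‖y - z‖) := by gcongr
    _ = ε * ‖y - z‖ := by field_simp

lemma speed_bound {S : ℝ → Set E} {Ψ : ℝ → ℝ} {r d : ℝ} {x w : E} (hx : x ∈ S (Ψ r))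
    (hΨ : HasDerivAt Ψ d r) (hd : 0 < d)
    (h : (‖w‖ ^ 2, -w) ∈ frechetNCP (sgraph S) (Ψ r, x))
    (hm : asymMod (fun s => S (Ψ s)) r x ≤ 1) : ‖w‖ ≤ d⁻¹ := by
  rcases eq_or_ne w 0 with rfl | hw
  · simpa using hd.le
  have hwn : 0 < ‖w‖ := norm_pos_iff.2 hw
  have h1 := frechetNCP_smul (inv_pos.2 hwn) (transfer hΨ h)
  have e1 : ‖w‖⁻¹ • (‖w‖ ^ 2 * d, -w) = (‖w‖ * d, -(‖w‖⁻¹ • w)) := by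
    ext
    · simp only [Prod.smul_mk, smul_eq_mul]; field_simp
    · simp
  rw [e1] at h1
  have h2 : ‖w‖ * d ∈ coderiv (fun s => S (Ψ s)) r x (‖w‖⁻¹ • w) :=
    ⟨fun _ => (r, x), fun _ => (‖w‖ * d, -(‖w‖⁻¹ • w)), fun _ => hx, fun _ => h1,
      tendsto_const_nhds, tendsto_const_nhds⟩
  have hn : ‖‖w‖⁻¹ • w‖ ≤ 1 := by
    rw [norm_smul, norm_inv, norm_norm, inv_mul_cancel₀ hwn.ne']
  have h3 : ENNReal.ofReal (‖w‖ * d) ≤ 1 := by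
    refine le_trans ?_ hm
    unfold asymMod
    exact le_iSup₂_of_le (‖w‖⁻¹ • w) hn (le_iSup₂_of_le (‖w‖ * d) h2 le_rfl)
  rw [ENNReal.ofReal_le_one] at h3
  rwa [← one_div, le_div_iff₀ hd]

end Helpers

/-- Theorem A, (a) ⇒ (b): a desingularization `Ψ` of the oriented
coderivative yields the uniform length control `ℓ(γ) ≤ σ(t₂) - σ(t₁)`, `σ := Ψ⁻¹`,
for all absolutely continuous orbits. -/
theorem statement0 {E : Type*} [NormedAddCommGroup E] [InnerProductSpace ℝ E]
    [FiniteDimensional ℝ E] (S : ℝ → Set E)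
    (hS : SmoothSweepingProcess S) (hbv : BoundedValues S) (hA1 : AssumptionA1 S)
    (a : ℝ) (ha : a ∈ goodSet S) (b ρ : ℝ) (hab : a < b) (hρ : 0 < ρ)
    (Ψ Ψd : ℝ → ℝ)
    (hΨcont : ContinuousOn Ψ (Icc 0 ρ)) (hΨinj : InjOn Ψ (Icc 0 ρ))
    (hΨimg : Ψ '' Icc 0 ρ = Icc a b) (hΨ0 : Ψ 0 = a) (hΨρ : Ψ ρ = b)
    (hΨderiv : ∀ r ∈ Ioo 0 ρ, HasDerivAt Ψ (Ψd r) r)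
    (hΨdcont : ContinuousOn Ψd (Ioo 0 ρ))
    (hΨdpos : ∀ r ∈ Ioo 0 ρ, 0 < Ψd r)
    (hdesing : ∀ r ∈ Ioo 0 ρ, ∀ x ∈ S (Ψ r), asymMod (fun s => S (Ψ s)) r x ≤ 1)
    (σ : ℝ → ℝ) (hσ : ∀ r ∈ Icc 0 ρ, σ (Ψ r) = r) :
    ∀ t₁ t₂ : ℝ, a ≤ t₁ → t₁ < t₂ → t₂ ≤ b →
      ∀ γ γ' : ℝ → E, ACOrbit S (Icc t₁ t₂) γ γ' →
        ∫⁻ t in Icc t₁ t₂, (‖γ' t‖₊ : ℝ≥0∞) ≤ ENNReal.ofReal (σ t₂ - σ t₁) := by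
  intro t₁ t₂ hat ht htb γ γ' horb
  obtain ⟨hγS, hγi, hγint, hγn⟩ := horb
  have hmono : StrictMonoOn Ψ (Icc 0 ρ) := by
    refine strictMonoOn_of_deriv_pos (convex_Icc 0 ρ) hΨcont ?_
    intro r hr
    rw [interior_Icc] at hr
    rw [(hΨderiv r hr).deriv]
    exact hΨdpos r hr
  have hσm : ∀ t ∈ Icc a b, σ t ∈ Icc 0 ρ ∧ Ψ (σ t) = t := by
    intro t ht
    rw [← hΨimg] at ht
    obtain ⟨r, hr, rfl⟩ := ht
    rw [hσ r hr]
    exact ⟨hr, rfl⟩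
  have hσmono : StrictMonoOn σ (Icc a b) := by
    intro s hs t ht hst
    have h1 := hσm s hs
    have h2 := hσm t ht
    rw [← h1.2, ← h2.2] at hst
    exact (hmono.lt_iff_lt h1.1 h2.1).1 hst
  have h0 : (0 : ℝ) ∈ Icc 0 ρ := ⟨le_rfl, hρ.le⟩
  have h1 : ρ ∈ Icc 0 ρ := ⟨hρ.le, le_rfl⟩
  have hσo : ∀ t ∈ Ioo a b, σ t ∈ Ioo 0 ρ := by
    intro t ht
    have hti := Ioo_subset_Icc_self ht
    have e0 : σ a = 0 := by rw [← hΨ0]; exact hσ 0 h0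
    have e1 : σ b = ρ := by rw [← hΨρ]; exact hσ ρ h1
    constructor
    · rw [← e0]; exact hσmono ⟨le_rfl, hab.le⟩ hti ht.1
    · rw [← e1]; exact hσmono hti ⟨hab.le, le_rfl⟩ ht.2
  have hσd : ∀ t ∈ Ioo a b, HasDerivAt σ (Ψd (σ t))⁻¹ t := by
    intro t ht
    have hn : Icc a b ∈ 𝓝 t := Icc_mem_nhds ht.1 ht.2
    have him : σ '' Icc a b = Icc 0 ρ := by
      rw [← hΨimg, image_image]
      ext r
      constructor
      · rintro ⟨s, hs, rfl⟩
        simpa only [hσ s hs] using hs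
      · intro hr
        exact ⟨r, hr, hσ r hr⟩
    have hσt := hσo t ht
    have hc : ContinuousAt σ t :=
      hσmono.continuousAt_of_image_mem_nhds hn (by rw [him]; exact Icc_mem_nhds hσt.1 hσt.2)
    refine HasDerivAt.of_local_left_inverse hc (hΨderiv _ hσt) (hΨdpos _ hσt).ne' ?_
    filter_upwards [hn] with y hy
    exact (hσm y hy).2
  have hsub : Ioo t₁ t₂ ⊆ Ioo a b := Ioo_subset_Ioo hat htb
  have : CompleteSpace E := FiniteDimensional.complete ℝ E
  have hii : IntervalIntegrable γ' volume t₁ t₂ :=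
    (intervalIntegrable_iff_integrableOn_Icc_of_le ht.le).2 hγi
  have hae := hii.ae_hasDerivAt_integral
  rw [ae_restrict_iff' measurableSet_Icc] at hγn
  have hbound : ∀ᵐ t ∂(volume.restrict (Ioo t₁ t₂)),
      (‖γ' t‖₊ : ℝ≥0∞) ≤ ENNReal.ofReal ((Ψd (σ t))⁻¹) := by
    rw [ae_restrict_iff' measurableSet_Ioo]
    filter_upwards [hae, hγn] with t hd hn htI
    have htc : t ∈ Icc t₁ t₂ := Ioo_subset_Icc_self htI
    have hd1 := hd (by rwa [uIcc_of_le ht.le]) t₁ left_mem_uIcc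
    have hγd : HasDerivAt γ (γ' t) t := by
      refine (hd1.const_add (γ t₁)).congr_of_eventuallyEq ?_
      filter_upwards [Icc_mem_nhds htI.1 htI.2] with s hs
      rw [← hγint t₁ ⟨le_rfl, ht.le⟩ s hs]
      abel
    have hmem : ∀ᶠ s in 𝓝 t, γ s ∈ S s := by
      filter_upwards [Icc_mem_nhds htI.1 htI.2] with s hs
      exact hγS s hs
    have hk := key_normal hS hγd hmem (hn htc)
    have htab := hsub htI
    have hσt := hσo t htab
    have hΨσ := (hσm t (Ioo_subset_Icc_self htab)).2
    have hxS : γ t ∈ S (Ψ (σ t)) := by rw [hΨσ]; exact hγS t htc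
    have hle := speed_bound hxS (hΨderiv _ hσt) (hΨdpos _ hσt) (by rw [hΨσ]; exact hk)
      (hdesing _ hσt _ hxS)
    rw [← enorm_eq_nnnorm, ← ofReal_norm]
    exact ENNReal.ofReal_le_ofReal hle
  have hmonoI : MonotoneOn σ (Ioo t₁ t₂) :=
    hσmono.monotoneOn.mono (hsub.trans Ioo_subset_Icc_self)
  calc ∫⁻ t in Icc t₁ t₂, (‖γ' t‖₊ : ℝ≥0∞) = ∫⁻ t in Ioo t₁ t₂, (‖γ' t‖₊ : ℝ≥0∞) :=
        setLIntegral_congr Ioo_ae_eq_Icc.symm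
    _ ≤ ∫⁻ t in Ioo t₁ t₂, ENNReal.ofReal ((Ψd (σ t))⁻¹) := lintegral_mono_ae hbound
    _ = volume (σ '' Ioo t₁ t₂) :=
        lintegral_deriv_eq_volume_image_of_monotoneOn measurableSet_Ioo
          (fun t ht => (hσd t (hsub ht)).hasDerivWithinAt) hmonoI
    _ ≤ volume (Icc (σ t₁) (σ t₂)) := by
        apply measure_mono
        rintro _ ⟨s, hs, rfl⟩
        have m1 : t₁ ∈ Icc a b := ⟨hat, ht.le.trans htb⟩
        have m2 : t₂ ∈ Icc a b := ⟨hat.trans ht.le, htb⟩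
        have ms : s ∈ Icc a b := Ioo_subset_Icc_self (hsub hs)
        exact ⟨hσmono.monotoneOn m1 ms hs.1.le, hσmono.monotoneOn ms m2 hs.2.le⟩
    _ = ENNReal.ofReal (σ t₂ - σ t₁) := Real.volume_Icc
end

section
/- Let S : ℝ ⇒ ℝⁿ be a smooth sweeping process with bounded values satisfying assumption (A1), and let a ∈ 𝒯. Suppose there exist b > a and C > 0 such that every piecewise catching-up sequence (t⁰₀,Y⁰₀),…,(t⁰_{k₀},Y⁰_{k₀}),(t¹₀,Y¹₀),… for S with all times in (a,b) satisfies Σ_{j≥0} Σ_{i=0}^{k_j−1} ‖Yʲ_{i+1} − Yʲᵢ‖ ≤ C. Then there exists b' ∈ (a,b] such that the oriented talweg φ↑ is integrable on (a,b'); more precisely, ∫_c^d φ↑(t) dt ≤ C for every compact interval [c,d] ⊂ (a,b'), and hence ∫_{a}^{b'} φ↑(t) dt ≤ C < ∞. -/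
open Set Metric Filter MeasureTheory
open scoped ENNReal RealInnerProductSpace Topology Pointwise

section Geo

variable {X : Type*} [NormedAddCommGroup X] [NormedSpace ℝ X]

/-- Fréchet normality of a functional. -/
def FN (C : Set X) (z : X) (l : X →L[ℝ] ℝ) : Prop :=
  ∀ ε : ℝ, 0 < ε → ∃ δ : ℝ, 0 < δ ∧ ∀ y ∈ C, ‖y - z‖ < δ → l (y - z) ≤ ε * ‖y - z‖

lemma FN.mono {C D : Set X} {z : X} {l : X →L[ℝ] ℝ} (h : FN C z l) (hD : D ⊆ C) : FN D z l := by
  intro ε hε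
  obtain ⟨δ, hδ, H⟩ := h ε hε
  exact ⟨δ, hδ, fun y hy => H y (hD hy)⟩

lemma FN.zero (C : Set X) (z : X) : FN C z 0 := by
  intro ε hε
  refine ⟨1, one_pos, fun y _ _ => ?_⟩
  simp only [_root_.zero_apply]
  positivity

lemma FN.curve {C : Set X} {z w : X} {l : X →L[ℝ] ℝ} (h : FN C z l) {y : ℝ → X}
    (hy : HasDerivAt y w 0) (hy0 : y 0 = z) (hC : ∃ᶠ s in 𝓝[>] (0 : ℝ), y s ∈ C) : l w ≤ 0 := by
  by_contra! hw
  obtain ⟨ε, hε, hεw⟩ : ∃ ε : ℝ, 0 < ε ∧ ε * ‖w‖ < l w := by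
    refine ⟨l w / (2 * (‖w‖ + 1)), by positivity, ?_⟩
    rw [div_mul_eq_mul_div, div_lt_iff₀ (by positivity)]
    nlinarith [norm_nonneg w]
  obtain ⟨δ, hδ, H⟩ := h ε hε
  have h1 : Tendsto (fun s : ℝ => s⁻¹ • (y s - z)) (𝓝[>] 0) (𝓝 w) := by
    have := hy.tendsto_slope_zero_right
    simpa [hy0] using this
  have h2 : Tendsto (fun s : ℝ => l (s⁻¹ • (y s - z)) - ε * ‖s⁻¹ • (y s - z)‖) (𝓝[>] 0)
      (𝓝 (l w - ε * ‖w‖)) :=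
    ((l.continuous.tendsto w).comp h1).sub (h1.norm.const_mul ε)
  have h3 : ∀ᶠ s in 𝓝[>] (0 : ℝ), 0 < l (s⁻¹ • (y s - z)) - ε * ‖s⁻¹ • (y s - z)‖ :=
    h2.eventually (lt_mem_nhds (by linarith))
  have h4 : ∀ᶠ s in 𝓝[>] (0 : ℝ), ‖y s - z‖ < δ := by
    have : Tendsto (fun s => ‖y s - z‖) (𝓝[>] 0) (𝓝 0) := by
      have h5 : Tendsto y (𝓝[>] 0) (𝓝 z) := by
        have := hy.continuousAt.tendsto
        rw [hy0] at this
        exact this.mono_left nhdsWithin_le_nhds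
      simpa using (h5.sub (tendsto_const_nhds (x := z))).norm
    exact this.eventually (gt_mem_nhds hδ)
  obtain ⟨s, hs, hs3, hs4, hs0⟩ :=
    (hC.and_eventually (h3.and (h4.and self_mem_nhdsWithin))).exists
  have hs0 : 0 < s := hs0
  have := H _ hs hs4
  rw [map_smul, norm_smul, Real.norm_of_nonneg (by positivity), smul_eq_mul] at hs3
  have : s⁻¹ * l (y s - z) ≤ s⁻¹ * (ε * ‖y s - z‖) := by gcongr
  nlinarith

lemma line_deriv (z w : X) : HasDerivAt (fun s : ℝ => z + s • w) w 0 := by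
  simpa using ((hasDerivAt_id (0 : ℝ)).smul_const w).const_add z

lemma FN.eq_zero_of_interior {C : Set X} {z : X} {l : X →L[ℝ] ℝ} (h : FN C z l)
    (hz : z ∈ interior C) : l = 0 := by
  have key : ∀ w, l w ≤ 0 := by
    intro w
    refine h.curve (line_deriv z w) (by simp) ?_
    have : Tendsto (fun s : ℝ => z + s • w) (𝓝[>] 0) (𝓝 z) := by
      have := (line_deriv z w).continuousAt.tendsto
      simp only [zero_smul, add_zero] at this
      exact this.mono_left nhdsWithin_le_nhds
    exact (this.eventually (mem_interior_iff_mem_nhds.1 hz)).frequently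
  ext w
  have h1 := key w
  have h2 := key (-w)
  simp only [map_neg] at h2
  simp only [_root_.zero_apply]
  linarith

variable [CompleteSpace X] {F : Type*} [NormedAddCommGroup F] [NormedSpace ℝ F]
  [FiniteDimensional ℝ F]

lemma FN.ker {C : Set X} {z : X} {l : X →L[ℝ] ℝ} (h : FN C z l) {f : X → F} {f' : X →L[ℝ] F}
    (hf : HasStrictFDerivAt f f' z) (hf' : f'.range = ⊤) (hfC : ∀ᶠ y in 𝓝 z, f y = f z → y ∈ C)
    (w : X) (hw : f' w = 0) : l w = 0 := by
  have key : ∀ w, f' w = 0 → l w ≤ 0 := by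
    intro w hw
    let w' : f'.ker := ⟨w, hw⟩
    let g := hf.implicitFunction f f' hf' (f z)
    have hg : HasStrictFDerivAt g f'.ker.subtypeL 0 := hf.to_implicitFunction hf'
    have hg0 : g 0 = z := hf.implicitFunction_apply_image hf'
    have hd : HasDerivAt (fun s : ℝ => g (s • w')) w 0 := by
      have h1 : HasDerivAt (fun s : ℝ => s • w') w' 0 := by
        simpa using (hasDerivAt_id (0 : ℝ)).smul_const w'
      have h2 : HasFDerivAt g f'.ker.subtypeL ((0 : ℝ) • w') := by
        rw [zero_smul]; exact hg.hasFDerivAt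
      exact h2.comp_hasDerivAt (0 : ℝ) h1
    refine h.curve hd (by simp [hg0]) (Eventually.frequently ?_)
    have t1 : Tendsto (fun s : ℝ => s • w') (𝓝[>] 0) (𝓝 0) := by
      have : ContinuousAt (fun s : ℝ => s • w') 0 := by fun_prop
      have := this.tendsto
      rw [zero_smul] at this
      exact this.mono_left nhdsWithin_le_nhds
    have t2 : Tendsto (fun s : ℝ => g (s • w')) (𝓝[>] 0) (𝓝 z) := by
      have := hd.continuousAt.tendsto
      simp only [zero_smul, hg0] at this
      exact this.mono_left nhdsWithin_le_nhds
    have t3 : ∀ᶠ s : ℝ in 𝓝[>] 0, f (g (s • w')) = f z :=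
      ((tendsto_const_nhds (x := f z)).prodMk_nhds t1).eventually (hf.map_implicitFunction_eq hf')
    filter_upwards [t2.eventually hfC, t3] with s h1 h2 using h1 h2
  have h1 := key w hw
  have h2 := key (-w) (by simp [hw])
  simp only [map_neg] at h2
  linarith

lemma tendsto_clm {A : ℕ → X →L[ℝ] F} {A0 : X →L[ℝ] F} {x : ℕ → X} {x0 : X}
    (hA : Tendsto A atTop (𝓝 A0)) (hx : Tendsto x atTop (𝓝 x0)) :
    Tendsto (fun i => A i (x i)) atTop (𝓝 (A0 x0)) :=
  (isBoundedBilinearMap_apply (𝕜 := ℝ) (E := X) (F := F)).continuous.tendsto (A0, x0) |>.comp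
    (hA.prodMk_nhds hx)

lemma ker_limit {A : ℕ → X →L[ℝ] F} {A0 : X →L[ℝ] F} {R : F →L[ℝ] X} {l : ℕ → X →L[ℝ] ℝ}
    {l0 : X →L[ℝ] ℝ} (hA : Tendsto A atTop (𝓝 A0)) (hl : Tendsto l atTop (𝓝 l0))
    (hR : A0.comp R = ContinuousLinearMap.id ℝ F)
    (hk : ∀ᶠ i in atTop, ∀ w, A i w = 0 → l i w = 0) (w : X) (hw : A0 w = 0) : l0 w = 0 := by
  have : CompleteSpace F := FiniteDimensional.complete ℝ F
  let B : ℕ → F →L[ℝ] F := fun i => (A i).comp R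
  have hB : Tendsto B atTop (𝓝 1) := by
    have : Tendsto B atTop (𝓝 (A0.comp R)) :=
      ((ContinuousLinearMap.compL ℝ F X F).flip R).continuous.tendsto A0 |>.comp hA
    rwa [hR] at this
  have hBi : Tendsto (fun i => Ring.inverse (B i)) atTop (𝓝 1) := by
    have := (NormedRing.inverse_continuousAt (1 : (F →L[ℝ] F)ˣ)).tendsto
    simp only [Units.val_one, Ring.inverse_one] at this
    exact this.comp hB
  have hBu : ∀ᶠ i in atTop, IsUnit (B i) := by
    have : ∀ᶠ T in 𝓝 (1 : F →L[ℝ] F), IsUnit T := Units.nhds (1 : (F →L[ℝ] F)ˣ)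
    exact hB.eventually this
  have hAw : Tendsto (fun i => A i w) atTop (𝓝 0) := by
    have := tendsto_clm hA (tendsto_const_nhds (x := w))
    rwa [hw] at this
  let ws : ℕ → X := fun i => w - R (Ring.inverse (B i) (A i w))
  have hws : Tendsto ws atTop (𝓝 w) := by
    have h1 := tendsto_clm hBi hAw
    have h2 := (R.continuous.tendsto _).comp h1
    have h3 := (tendsto_const_nhds (x := w)).sub h2
    simpa using h3
  have hlim : Tendsto (fun i => l i (ws i)) atTop (𝓝 (l0 w)) := tendsto_clm hl hws
  have hz : (fun i => l i (ws i)) =ᶠ[atTop] fun _ => 0 := by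
    filter_upwards [hk, hBu] with i hi hu
    apply hi
    have : B i (Ring.inverse (B i) (A i w)) = A i w := by
      have := Ring.mul_inverse_cancel (B i) hu
      exact congrArg (fun T : F →L[ℝ] F => T (A i w)) this
    simp only [ws, map_sub]
    exact sub_eq_zero.2 this.symm
  exact tendsto_nhds_unique hlim (tendsto_const_nhds.congr' hz.symm)

/-- strict differentiability bound on one side gives a Fréchet normal. -/
lemma FN.of_le {C : Set X} {z : X} {l : X →L[ℝ] ℝ} {g : X → ℝ} (hg : HasFDerivAt g l z)
    (h : ∀ᶠ y in 𝓝 z, y ∈ C → g y ≤ g z) : FN C z l := by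
  intro ε hε
  have h1 := (hasFDerivAt_iff_isLittleO.1 hg).def hε
  obtain ⟨δ, hδ, H⟩ := Metric.eventually_nhds_iff.1 (h.and h1)
  refine ⟨δ, hδ, fun y hy hyz => ?_⟩
  obtain ⟨h2, h3⟩ := H (y := y) (by rwa [dist_eq_norm])
  have := h2 hy
  have := neg_le_of_abs_le h3
  linarith

/-- one-sidedness near a regular frontier point -/
lemma one_side_s6 {C : Set X} (hC : IsClosed C) {z : X} {l : X →L[ℝ] ℝ} {g : X → ℝ}
    (hg : HasStrictFDerivAt g l z) (hl : l.range = ⊤) (hgz : g z = 0)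
    (hfr : ∀ᶠ y in 𝓝 z, y ∈ frontier C → g y = 0)
    (hout : ∃ᶠ y in 𝓝 z, 0 < g y ∧ y ∉ C) :
    ∀ᶠ y in 𝓝 z, y ∈ C → g y ≤ g z := by
  let Φ := hg.implicitToOpenPartialHomeomorph g l hl
  have hzs : z ∈ Φ.source := hg.mem_implicitToOpenPartialHomeomorph_source hl
  have hΦ : ∀ y, (Φ y).1 = g y := fun y => hg.implicitToOpenPartialHomeomorph_fst hl y
  obtain ⟨U, hU, hUo, hzU⟩ := _root_.mem_nhds_iff.1 hfr
  have hV : Φ.target ∩ Φ.symm ⁻¹' U ∈ 𝓝 (Φ z) := by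
    refine inter_mem (Φ.open_target.mem_nhds (Φ.map_source hzs)) ?_
    exact (Φ.tendsto_symm hzs).eventually (hUo.mem_nhds hzU)
  obtain ⟨r, hr, hrV⟩ := Metric.mem_nhds_iff.1 hV
  let Q : Set (ℝ × l.ker) := ball (Φ z) r ∩ {p | 0 < p.1}
  have hQ : Convex ℝ Q := by
    refine (convex_ball _ _).inter ?_
    exact convex_halfSpace_gt (LinearMap.fst ℝ ℝ l.ker).isLinear 0
  have hQt : Q ⊆ Φ.target := fun p hp => (hrV hp.1).1
  have hW : IsPreconnected (Φ.symm '' Q) :=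
    hQ.isPreconnected.image _ (Φ.continuousOn_symm.mono hQt)
  have hgW : ∀ p ∈ Q, 0 < g (Φ.symm p) := by
    intro p hp
    rw [← hΦ, Φ.right_inv (hQt hp)]
    exact hp.2
  have hB : ∀ᶠ y in 𝓝 z, y ∈ Φ.source ∧ Φ y ∈ ball (Φ z) r :=
    Filter.Eventually.and (Φ.open_source.mem_nhds hzs)
      ((Φ.continuousAt hzs).eventually (ball_mem_nhds _ hr))
  have hin : ∀ y, y ∈ Φ.source ∧ Φ y ∈ ball (Φ z) r → 0 < g y → y ∈ Φ.symm '' Q := by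
    rintro y ⟨h1, h2⟩ h3
    exact ⟨Φ y, ⟨h2, by simpa [hΦ] using h3⟩, Φ.left_inv h1⟩
  filter_upwards [hB] with y hy hyC
  rw [hgz]
  by_contra! hgy
  obtain ⟨y', ⟨hyPos, hyOut⟩, hy'⟩ := (hout.and_eventually hB).exists
  have hsub : Φ.symm '' Q ⊆ interior C ∪ Cᶜ := by
    rintro _ ⟨p, hp, rfl⟩
    by_cases hc : Φ.symm p ∈ C
    · left
      by_contra hni
      have : Φ.symm p ∈ frontier C := by
        rw [hC.frontier_eq]; exact ⟨hc, hni⟩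
      have h0 := hU (hrV hp.1).2 this
      exact (hgW p hp).ne' h0
    · right; exact hc
  have hyW := hin y hy hgy
  have h1 : (Φ.symm '' Q ∩ interior C).Nonempty := by
    refine ⟨y, hyW, ?_⟩
    rcases hsub hyW with h | h
    · exact h
    · exact absurd hyC h
  have h2 : (Φ.symm '' Q ∩ Cᶜ).Nonempty := ⟨y', hin y' hy' hyPos, hyOut⟩
  obtain ⟨p, -, hp1, hp2⟩ := hW _ _ isOpen_interior hC.isOpen_compl hsub h1 h2
  exact hp2 (interior_subset hp1)


lemma man_ker {C M : Set X} (hMC : M ⊆ C) {z : X} {U : Set X} (hU : IsOpen U) (hzU : z ∈ U)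
    {f : X → F} (hf : ContDiffOn ℝ 1 f U)
    (hsurj : ∀ y ∈ U, Function.Surjective ⇑(fderivWithin ℝ f U y))
    (hM : M ∩ U = {y ∈ U | f y = 0}) {zs : ℕ → X} {l : ℕ → X →L[ℝ] ℝ} {l0 : X →L[ℝ] ℝ}
    (hzs : Tendsto zs atTop (𝓝 z)) (hl : Tendsto l atTop (𝓝 l0))
    (hzM : ∀ᶠ i in atTop, zs i ∈ M) (hFN : ∀ i, FN C (zs i) (l i)) :
    ∃ R : F →L[ℝ] X, (fderiv ℝ f z).comp R = ContinuousLinearMap.id ℝ F ∧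
      l0 = (l0.comp R).comp (fderiv ℝ f z) := by
  have hsurj' : ∀ y ∈ U, (fderiv ℝ f y).range = ⊤ := by
    intro y hy
    have := hsurj y hy
    rw [fderivWithin_of_isOpen hU hy] at this
    exact LinearMap.range_eq_top.2 this
  obtain ⟨R, hR⟩ := (fderiv ℝ f z).exists_rightInverse_of_surjective (hsurj' z hzU)
  have hcont : ContinuousAt (fderiv ℝ f) z :=
    (hf.continuousOn_fderiv_of_isOpen hU le_rfl).continuousAt (hU.mem_nhds hzU)
  have hker := ker_limit (A := fun i => fderiv ℝ f (zs i)) (hcont.tendsto.comp hzs) hl hR (by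
    filter_upwards [hzM, hzs.eventually (hU.mem_nhds hzU)] with i hi hiU w hw
    have hst : HasStrictFDerivAt f (fderiv ℝ f (zs i)) (zs i) :=
      (hf.contDiffAt (hU.mem_nhds hiU)).hasStrictFDerivAt one_ne_zero
    have h0 : f (zs i) = 0 := by
      have : zs i ∈ M ∩ U := ⟨hi, hiU⟩
      rw [hM] at this
      exact this.2
    refine ((hFN i).mono hMC).ker hst (hsurj' _ hiU) ?_ w hw
    filter_upwards [hU.mem_nhds hiU] with y hy hy0
    have : y ∈ M ∩ U := by rw [hM]; exact ⟨hy, hy0.trans h0⟩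
    exact this.1)
  refine ⟨R, hR, ?_⟩
  ext x
  have hRR : ∀ v, fderiv ℝ f z (R v) = v := fun v => congrArg (fun T : F →L[ℝ] F => T v) hR
  have := hker (x - R (fderiv ℝ f z x)) (by rw [map_sub, hRR, sub_self])
  rw [map_sub, sub_eq_zero] at this
  simpa using this

lemma reg1 {M : Set X} {z : X} (hz : z ∈ M) {U : Set X} (hU : IsOpen U) (hzU : z ∈ U)
    {f : X → F} (hf : ContDiffOn ℝ 1 f U)
    (hsurj : ∀ y ∈ U, Function.Surjective ⇑(fderivWithin ℝ f U y))
    (hM : M ∩ U = {y ∈ U | f y = 0}) {zs : ℕ → X} {l : ℕ → X →L[ℝ] ℝ} {l0 : X →L[ℝ] ℝ}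
    (hzs : Tendsto zs atTop (𝓝 z)) (hl : Tendsto l atTop (𝓝 l0))
    (hzM : ∀ i, zs i ∈ M) (hFN : ∀ i, FN M (zs i) (l i)) : FN M z l0 := by
  obtain ⟨R, hR, hl0⟩ := man_ker subset_rfl hU hzU hf hsurj hM hzs hl (Eventually.of_forall hzM) hFN
  have hd : HasFDerivAt f (fderiv ℝ f z) z :=
    ((hf.contDiffAt (hU.mem_nhds hzU)).differentiableAt one_ne_zero).hasFDerivAt
  have hg : HasFDerivAt (fun y => (l0.comp R) (f y)) l0 z := by
    have := (l0.comp R).hasFDerivAt.comp z hd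
    rw [← hl0] at this
    exact this
  refine FN.of_le hg ?_
  have hM0 : ∀ y ∈ U, y ∈ M → f y = 0 := by
    intro y hy hyM
    have : y ∈ M ∩ U := ⟨hyM, hy⟩
    rw [hM] at this
    exact this.2
  filter_upwards [hU.mem_nhds hzU] with y hy hyM
  rw [hM0 y hy hyM, hM0 z hzU hz]

lemma reg2 {C : Set X} (hC : IsClosed C) {z : X} (hz : z ∈ frontier C) {U : Set X}
    (hU : IsOpen U) (hzU : z ∈ U)
    {f : X → EuclideanSpace ℝ (Fin 1)} (hf : ContDiffOn ℝ 1 f U)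
    (hsurj : ∀ y ∈ U, Function.Surjective ⇑(fderivWithin ℝ f U y))
    (hM : frontier C ∩ U = {y ∈ U | f y = 0}) {zs : ℕ → X} {l : ℕ → X →L[ℝ] ℝ} {l0 : X →L[ℝ] ℝ}
    (hzs : Tendsto zs atTop (𝓝 z)) (hl : Tendsto l atTop (𝓝 l0)) (hl0 : l0 ≠ 0)
    (hzM : ∀ᶠ i in atTop, zs i ∈ frontier C) (hFN : ∀ i, FN C (zs i) (l i)) : FN C z l0 := by
  obtain ⟨R, hR, hlR⟩ := man_ker hC.frontier_subset hU hzU hf hsurj hM hzs hl hzM hFN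
  let g : X → ℝ := fun y => (l0.comp R) (f y)
  have hM0 : ∀ y ∈ U, y ∈ frontier C → g y = 0 := by
    intro y hy hyM
    have : y ∈ frontier C ∩ U := ⟨hyM, hy⟩
    rw [hM] at this
    simp [g, this.2]
  have hgC : ContDiffOn ℝ 1 g U := (l0.comp R).contDiff.comp_contDiffOn hf
  have hst : ∀ y ∈ U, HasStrictFDerivAt g (fderiv ℝ g y) y := fun y hy =>
    (hgC.contDiffAt (hU.mem_nhds hy)).hasStrictFDerivAt one_ne_zero
  have hgz : fderiv ℝ g z = l0 := by
    have hd : HasFDerivAt f (fderiv ℝ f z) z :=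
      ((hf.contDiffAt (hU.mem_nhds hzU)).differentiableAt one_ne_zero).hasFDerivAt
    have := (l0.comp R).hasFDerivAt.comp z hd
    rw [← hlR] at this
    exact this.fderiv
  have hsz := hst z hzU
  rw [hgz] at hsz
  obtain ⟨e, he⟩ : ∃ e, 0 < l0 e := by
    by_contra! h
    apply hl0
    ext w
    have h1 := h w
    have h2 := h (-w)
    simp only [map_neg] at h2
    simp only [_root_.zero_apply]
    linarith
  have hrange : l0.range = ⊤ := by
    refine LinearMap.range_eq_top.2 fun r => ⟨(r / l0 e) • e, ?_⟩
    change l0 ((r / l0 e) • e) = r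
    rw [map_smul, smul_eq_mul, div_mul_cancel₀ _ he.ne']
  refine FN.of_le hsz.hasFDerivAt (one_side_s6 hC hsz hrange (hM0 z hzU hz) ?_ ?_)
  · filter_upwards [hU.mem_nhds hzU] with y hy using hM0 y hy
  · rw [Filter.frequently_iff]
    intro V hV
    have hcont : ContinuousAt (fderiv ℝ g) z :=
      (hgC.continuousOn_fderiv_of_isOpen hU le_rfl).continuousAt (hU.mem_nhds hzU)
    have e1 : ∀ᶠ i in atTop, 0 < l i e :=
      (tendsto_clm hl (tendsto_const_nhds (x := e))).eventually (lt_mem_nhds he)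
    have e2 : ∀ᶠ i in atTop, 0 < fderiv ℝ g (zs i) e := by
      have h1 := hcont.tendsto.comp hzs
      have h2 := tendsto_clm h1 (tendsto_const_nhds (x := e))
      rw [hgz] at h2
      exact h2.eventually (lt_mem_nhds he)
    have e3 : ∀ᶠ i in atTop, V ∈ 𝓝 (zs i) := by
      exact hzs.eventually (eventually_mem_nhds_iff.2 hV)
    obtain ⟨i, hi1, hi2, hi3, hi4, hi5⟩ :=
      (e1.and (e2.and (e3.and (hzM.and (hzs.eventually (hU.mem_nhds hzU)))))).exists
    have hline := line_deriv (zs i) e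
    have n1 : ∀ᶠ s : ℝ in 𝓝[>] 0, zs i + s • e ∉ C := by
      by_contra hcon
      have : ∃ᶠ s : ℝ in 𝓝[>] 0, zs i + s • e ∈ C := by
        rw [Filter.not_eventually] at hcon
        simpa using hcon
      have := (hFN i).curve hline (by simp) this
      linarith
    have n2 : ∀ᶠ s : ℝ in 𝓝[>] 0, zs i + s • e ∈ V := by
      have := hline.continuousAt.tendsto
      simp only [zero_smul, add_zero] at this
      exact (this.mono_left nhdsWithin_le_nhds).eventually hi3
    have n3 : ∀ᶠ s : ℝ in 𝓝[>] 0, 0 < g (zs i + s • e) := by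
      have hd : HasDerivAt (fun s : ℝ => g (zs i + s • e)) (fderiv ℝ g (zs i) e) 0 := by
        have h2 : HasFDerivAt g (fderiv ℝ g (zs i)) (zs i + (0 : ℝ) • e) := by
          rw [zero_smul, add_zero]; exact (hst _ hi5).hasFDerivAt
        exact h2.comp_hasDerivAt (0 : ℝ) hline
      have := hd.tendsto_slope_zero_right
      simp only [zero_add, zero_smul, add_zero, hM0 _ hi5 hi4, sub_zero] at this
      filter_upwards [this.eventually (lt_mem_nhds hi2), self_mem_nhdsWithin] with s hs hs0
      have hs0 : 0 < s := hs0
      rw [smul_eq_mul] at hs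
      exact (pos_iff_pos_of_mul_pos hs).1 (by positivity)
    obtain ⟨s, hs1, hs2, hs3⟩ := (n1.and (n2.and n3)).exists
    exact ⟨_, hs2, hs3, hs1⟩

end Geo

section Sweep

variable {E : Type*} [NormedAddCommGroup E] [InnerProductSpace ℝ E]

/-- The functional associated with a vector of `ℝ × E`. -/
noncomputable def pfun (v : ℝ × E) : ℝ × E →L[ℝ] ℝ :=
  v.1 • ContinuousLinearMap.fst ℝ ℝ E +
    (innerSL ℝ v.2).comp (ContinuousLinearMap.snd ℝ ℝ E)

lemma pfun_apply (v w : ℝ × E) : pfun v w = pinner v w := by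
  simp [pfun, pinner]

lemma continuous_pfun : Continuous (pfun : ℝ × E → (ℝ × E →L[ℝ] ℝ)) := by
  unfold pfun
  refine Continuous.add (by fun_prop) ?_
  have h1 : Continuous fun v : ℝ × E => innerSL ℝ v.2 :=
    (innerSL ℝ).continuous.comp continuous_snd
  exact h1.clm_comp continuous_const

lemma mem_frechetNCP_iff {C : Set (ℝ × E)} {z v : ℝ × E} :
    v ∈ frechetNCP C z ↔ FN C z (pfun v) := by
  simp only [frechetNCP, FN, pfun_apply, mem_setOf_eq]

lemma limiting_sub [FiniteDimensional ℝ E] {S : ℝ → Set E} (hS : SmoothSweepingProcess S)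
    {z v : ℝ × E} (hz : z ∈ sgraph S) (hv : v ∈ limitingNCP (sgraph S) z) :
    v ∈ frechetNCP (sgraph S) z := by
  obtain ⟨hcl, -, hS⟩ := hS
  obtain ⟨zs, vs, hzs, hvs, hzt, hvt⟩ := hv
  have : CompleteSpace (ℝ × E) := FiniteDimensional.complete ℝ (ℝ × E)
  rw [mem_frechetNCP_iff]
  have hl : Tendsto (fun i => pfun (vs i)) atTop (𝓝 (pfun v)) :=
    (continuous_pfun.tendsto v).comp hvt
  have hFN : ∀ i, FN (sgraph S) (zs i) (pfun (vs i)) := fun i => mem_frechetNCP_iff.1 (hvs i)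
  rcases hS with ⟨c, -, hc⟩ | ⟨-, hc⟩
  · obtain ⟨U, hU, hzU, f, hf, hsurj, hM⟩ := hc z hz
    exact reg1 hz hU hzU hf hsurj hM hzt hl hzs hFN
  · by_cases h0 : pfun v = 0
    · rw [h0]; exact FN.zero _ _
    have hne : ∀ᶠ i in atTop, zs i ∈ frontier (sgraph S) := by
      filter_upwards [hl.eventually_ne h0] with i hi
      rw [hcl.frontier_eq]
      exact ⟨hzs i, fun h => hi ((hFN i).eq_zero_of_interior h)⟩
    have hzf : z ∈ frontier (sgraph S) := isClosed_frontier.mem_of_tendsto hzt hne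
    obtain ⟨U, hU, hzU, f, hf, hsurj, hM⟩ := hc z hzf
    exact reg2 hcl hzf hU hzU hf hsurj hM hzt hl h0 hne hFN

lemma step_lower {S : ℝ → Set E} {s α β : ℝ} {x u : E} (hu : ‖u‖ ≤ 1) (hβ : 0 ≤ β) (hαβ : β < α)
    (h : ((α, -u) : ℝ × E) ∈ frechetNCP (sgraph S) (s, x)) :
    ∃ h0 : ℝ, 0 < h0 ∧ ∀ r, 0 < r → r < h0 → ∀ y ∈ S (s + r), β * r ≤ ‖y - x‖ := by
  obtain ⟨δ, hδ, H⟩ := h ((α - β) / (1 + β)) (div_pos (by linarith) (by linarith))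
  refine ⟨δ / (1 + β), by positivity, fun r hr hrδ y hy => ?_⟩
  rw [lt_div_iff₀ (by positivity)] at hrδ
  by_cases hyx : ‖y - x‖ < δ
  · have h1 := H (s + r, y) hy (by
      rw [Prod.norm_def, max_lt_iff]
      refine ⟨?_, by simpa using hyx⟩
      simp only [Prod.fst_sub, add_sub_cancel_left, Real.norm_eq_abs, abs_of_pos hr]
      nlinarith)
    have h2 : ‖((s + r, y) : ℝ × E) - (s, x)‖ ≤ r + ‖y - x‖ := by
      rw [Prod.norm_def]
      refine max_le ?_ ?_
      · simp only [Prod.fst_sub, add_sub_cancel_left, Real.norm_eq_abs, abs_of_pos hr]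
        linarith [norm_nonneg (y - x)]
      · simp only [Prod.snd_sub]; linarith
    have h3 : ⟪u, y - x⟫ ≤ ‖y - x‖ := by
      refine (real_inner_le_norm _ _).trans ?_
      nlinarith [norm_nonneg (y - x)]
    simp only [pinner, Prod.fst_sub, Prod.snd_sub, add_sub_cancel_left, inner_neg_left] at h1
    set ε := (α - β) / (1 + β) with hε
    have hεp : 0 < ε := div_pos (by linarith) (by linarith)
    have h4 : ε * (1 + β) = α - β := div_mul_cancel₀ _ (by positivity)
    have h5 := mul_le_mul_of_nonneg_left h2 hεp.le
    have h6 : (1 + ε) * (β * r) ≤ (1 + ε) * ‖y - x‖ := by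
      have : (1 + ε) * (β * r) = (α - ε) * r := by
        have : α = β + ε * (1 + β) := by linarith
        rw [this]; ring
      rw [this]; nlinarith
    exact le_of_mul_le_mul_left h6 (by linarith)
  · push Not at hyx
    nlinarith

/-- Lengths reachable at time `t` by one-step blocks with times in `I`. -/
inductive Reach (S : ℝ → Set E) (I : Set ℝ) : ℝ → ℝ → Prop
  | base (t : ℝ) (ht : t ∈ I) : Reach S I t 0
  | step (t r t' : ℝ) (x y : E) (h : Reach S I t r) (ht' : t' ∈ I) (htt : t < t') (hx : x ∈ S t)
      (hy : y ∈ S t') (hd : dist x y = infDist x (S t')) : Reach S I t' (r + ‖y - x‖)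

lemma Reach.mem {S : ℝ → Set E} {I : Set ℝ} {t r : ℝ} (h : Reach S I t r) : t ∈ I := by
  cases h <;> assumption

lemma Reach.nonneg {S : ℝ → Set E} {I : Set ℝ} {t r : ℝ} (h : Reach S I t r) : 0 ≤ r := by
  induction h with
  | base => exact le_rfl
  | step => positivity

lemma Reach.seq {S : ℝ → Set E} {I : Set ℝ} (hI : ∀ t ∈ I, (S t).Nonempty) {t r : ℝ}
    (h : Reach S I t r) :
    ∃ (k : ℕ → ℕ) (T : ℕ → ℕ → ℝ) (Y : ℕ → ℕ → E) (J : ℕ), PiecewiseCatchingUp S k T Y ∧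
      (∀ j, ∀ i ≤ k j, T j i ∈ I) ∧
      ∑ j ∈ Finset.range J, ∑ i ∈ Finset.range (k j), ‖Y j (i + 1) - Y j i‖ = r ∧
      ∀ j, J ≤ j → k j = 0 ∧ T j 0 = t := by
  induction h with
  | base t ht =>
    obtain ⟨x, hx⟩ := hI t ht
    refine ⟨fun _ => 0, fun _ _ => t, fun _ _ => x, 0, ⟨fun j => ⟨?_, ?_, ?_⟩, ?_⟩, ?_, ?_, ?_⟩ <;>
      simp [hx, ht]
  | step t r t' x y h ht' htt hx hy hd ih =>
    obtain ⟨k, T, Y, J, ⟨hP1, hP2⟩, hIn, hsum, hJ⟩ := ih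
    refine ⟨fun j => if j < J then k j else if j = J then 1 else 0,
      fun j => if j < J then T j else if j = J then (fun i => if i = 0 then t else t') else
        fun _ => t',
      fun j => if j < J then Y j else if j = J then (fun i => if i = 0 then x else y) else
        fun _ => y, J + 1, ⟨?_, ?_⟩, ?_, ?_, ?_⟩
    · intro j
      rcases lt_trichotomy j J with hj | rfl | hj
      · simpa [hj] using hP1 j
      · simp only [lt_irrefl, if_false, if_true]
        refine ⟨?_, ?_, ?_⟩
        · intro i hi
          obtain rfl : i = 0 := by omega
          simpa using htt
        · intro i hi
          rcases (by omega : i = 0 ∨ i = 1) with rfl | rfl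
          · simpa using hx
          · simpa using hy
        · intro i hi
          obtain rfl : i = 0 := by omega
          simpa using hd
      · simp only [hj.not_gt, hj.ne', if_false]
        refine ⟨by simp, ?_, by simp⟩
        intro i _
        exact hy
    · intro j
      rcases lt_trichotomy j J with hj | rfl | hj
      · rcases Nat.lt_or_ge (j + 1) J with hj1 | hj1
        · simpa [hj, hj1] using hP2 j
        · obtain rfl : j + 1 = J := by omega
          have := hP2 j
          rw [(hJ (j + 1) le_rfl).2] at this
          simpa using this
      · simp
      · have h1 : ¬ (j + 1 < J) := by omega
        have h2 : j + 1 ≠ J := by omega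
        simp [hj.not_gt, hj.ne', h1, h2]
    · intro j i hi
      rcases lt_trichotomy j J with hj | rfl | hj
      · simp only [hj, if_true] at hi ⊢
        exact hIn j i hi
      · simp only [lt_irrefl, if_false, if_true] at hi ⊢
        split_ifs
        · exact h.mem
        · exact ht'
      · simp only [hj.not_gt, hj.ne', if_false]
        exact ht'
    · rw [Finset.sum_range_succ, ← hsum]
      congr 1
      · refine Finset.sum_congr rfl fun j hj => ?_
        have hj := Finset.mem_range.1 hj
        simp [hj]
      · simp
    · intro j hj
      have h1 : ¬ (j < J) := by omega
      have h2 : j ≠ J := by omega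
      simp [h1, h2]

lemma talweg_bound [FiniteDimensional ℝ E] (S : ℝ → Set E)
    (hS : SmoothSweepingProcess S) (a b : ℝ) (C : ℝ) (hC : 0 < C)
    (hne : ∀ t ∈ Ioo a b, (S t).Nonempty)
    (hR : ∀ t r, Reach S (Ioo a b) t r → r ≤ C) :
    ∫⁻ t in Ioo a b, orientedTalweg S t ≤ ENNReal.ofReal C := by
  have hcl : ∀ t, IsClosed (S t) := fun t =>
    hS.1.preimage (f := fun x : E => (t, x)) (by fun_prop)
  let A : ℝ → Set ℝ := fun s => insert 0 {r | ∃ τ ≤ s, Reach S (Ioo a b) τ r}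
  let V : ℝ → ℝ := fun s => sSup (A s)
  have hAC : ∀ s, ∀ r ∈ A s, r ≤ C := by
    rintro s r (rfl | ⟨τ, _, h⟩)
    · exact hC.le
    · exact hR _ _ h
  have hbdd : ∀ s, BddAbove (A s) := fun s => ⟨C, hAC s⟩
  have hAne : ∀ s, (A s).Nonempty := fun s => ⟨0, mem_insert _ _⟩
  have hV0 : ∀ s, 0 ≤ V s := fun s => le_csSup (hbdd s) (mem_insert _ _)
  have hVC : ∀ s, V s ≤ C := fun s => csSup_le (hAne s) (hAC s)
  have hmono : Monotone V := by
    intro s t hst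
    refine csSup_le_csSup (hbdd t) (hAne s) (insert_subset_insert ?_)
    rintro r ⟨τ, hτ, h⟩
    exact ⟨τ, hτ.trans hst, h⟩
  have hproj : ∀ t ∈ Ioo a b, ∀ x : E, ∃ y ∈ S t, dist x y = infDist x (S t) := by
    intro t ht x
    obtain ⟨y, hy, h⟩ := (hcl t).exists_infDist_eq_dist (hne t ht) x
    exact ⟨y, hy, h.symm⟩
  -- every sum can be prolonged to end exactly at `s`
  have hprol : ∀ s ∈ Ioo a b, ∀ r ∈ A s, ∃ r', r ≤ r' ∧ Reach S (Ioo a b) s r' := by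
    rintro s hs r (rfl | ⟨τ, hτ, h⟩)
    · exact ⟨0, le_rfl, Reach.base s hs⟩
    · rcases hτ.eq_or_lt with rfl | hlt
      · exact ⟨r, le_rfl, h⟩
      · obtain ⟨x, hx⟩ := hne τ h.mem
        obtain ⟨y, hy, hd⟩ := hproj s hs x
        exact ⟨_, by linarith [norm_nonneg (y - x)], Reach.step τ r s x y h hs hlt hx hy hd⟩
  have hinc : ∀ s ∈ Ioo a b, ∀ t ∈ Ioo a b, s < t → ∀ x ∈ S s, ∀ m,
      (∀ y ∈ S t, m ≤ ‖y - x‖) → V s + m ≤ V t := by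
    intro s hs t ht hst x hx m hm
    obtain ⟨y, hy, hd⟩ := hproj t ht x
    suffices V s ≤ V t - ‖y - x‖ by linarith [hm y hy]
    refine csSup_le (hAne s) fun r hr => ?_
    obtain ⟨r', hrr, h⟩ := hprol s hs r hr
    have : r' + ‖y - x‖ ≤ V t :=
      le_csSup (hbdd t) (Or.inr ⟨t, le_rfl, Reach.step s r' t x y h ht hst hx hy hd⟩)
    linarith
  have hae : ∀ᵐ s ∂(volume.restrict (Ioo a b)),
      orientedTalweg S s ≤ (hmono.stieltjesFunction.measure.rnDeriv volume s) := by
    filter_upwards [ae_restrict_of_ae hmono.ae_hasDerivAt, ae_restrict_mem measurableSet_Ioo]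
      with s hs hsI
    refine le_trans ?_ (ENNReal.ofReal_toReal_le)
    set D := (hmono.stieltjesFunction.measure.rnDeriv volume s).toReal
    refine iSup₂_le fun x hx => iSup₂_le fun u hu => iSup₂_le fun α hα => ?_
    have hfr := limiting_sub hS (show ((s, x) : ℝ × E) ∈ sgraph S from hx) hα
    have hD0 : 0 ≤ D := ENNReal.toReal_nonneg
    rcases le_or_gt α 0 with hα0 | hα0
    · exact ENNReal.ofReal_le_ofReal (hα0.trans hD0)
    refine ENNReal.ofReal_le_ofReal (le_of_forall_lt_imp_le_of_dense fun β hβα => ?_)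
    rcases lt_or_ge β 0 with hβ0 | hβ0
    · exact hβ0.le.trans hD0
    obtain ⟨h0, hh0, H⟩ := step_lower hu hβ0 hβα hfr
    have hsl := hs.tendsto_slope_zero_right
    refine ge_of_tendsto hsl ?_
    have hm : (0 : ℝ) < min h0 (b - s) := lt_min hh0 (by linarith [hsI.2])
    filter_upwards [Ioo_mem_nhdsGT hm] with r hr
    obtain ⟨hr1, hr2⟩ := lt_min_iff.1 hr.2
    have := hinc s hsI (s + r) ⟨by linarith [hsI.1, hr.1], by linarith⟩ (by linarith [hr.1]) x hx
      (β * r) (H r hr.1 hr1)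
    rw [smul_eq_mul, inv_mul_eq_div, le_div_iff₀ hr.1]
    linarith
  calc ∫⁻ t in Ioo a b, orientedTalweg S t
      ≤ ∫⁻ t in Ioo a b, hmono.stieltjesFunction.measure.rnDeriv volume t := lintegral_mono_ae hae
    _ ≤ hmono.stieltjesFunction.measure (Ioo a b) := Measure.setLIntegral_rnDeriv_le _
    _ ≤ hmono.stieltjesFunction.measure (Ioc a b) := measure_mono Ioo_subset_Ioc_self
    _ = ENNReal.ofReal (hmono.stieltjesFunction b - hmono.stieltjesFunction a) :=
        StieltjesFunction.measure_Ioc _ _ _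
    _ ≤ ENNReal.ofReal C := by
        apply ENNReal.ofReal_le_ofReal
        have h1 : hmono.stieltjesFunction b ≤ C := by
          rw [hmono.stieltjesFunction_eq]
          exact (hmono.rightLim_le (lt_add_one b)).trans (hVC _)
        have h2 : 0 ≤ hmono.stieltjesFunction a := by
          rw [hmono.stieltjesFunction_eq]
          exact (hV0 a).trans (hmono.le_rightLim le_rfl)
        linarith

end Sweep

/-- Theorem B, (f) ⇒ (d): a uniform bound `C` on the lengths of all
piecewise catching-up sequences with times in `(a,b)` implies that the oriented talweg
is integrable near `a`, with `∫_c^d φ↑ ≤ C` on every compact `[c,d] ⊂ (a,b')`. -/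
theorem statement6 {E : Type*} [NormedAddCommGroup E] [InnerProductSpace ℝ E]
    [FiniteDimensional ℝ E] (S : ℝ → Set E)
    (hS : SmoothSweepingProcess S) (hbv : BoundedValues S) (hA1 : AssumptionA1 S)
    (a : ℝ) (ha : a ∈ goodSet S) (b : ℝ) (hab : a < b) (C : ℝ) (hC : 0 < C)
    (hbound : ∀ (k : ℕ → ℕ) (t : ℕ → ℕ → ℝ) (Y : ℕ → ℕ → E),
      PiecewiseCatchingUp S k t Y → (∀ j : ℕ, ∀ i ≤ k j, t j i ∈ Ioo a b) →
      ∀ J : ℕ, ∑ j ∈ Finset.range J, ∑ i ∈ Finset.range (k j), ‖Y j (i + 1) - Y j i‖ ≤ C) :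
    ∃ b' ∈ Ioc a b,
      (∀ c d : ℝ, a < c → c ≤ d → d < b' →
        ∫⁻ t in Icc c d, orientedTalweg S t ≤ ENNReal.ofReal C) ∧
      ∫⁻ t in Ioo a b', orientedTalweg S t ≤ ENNReal.ofReal C ∧
      ∫⁻ t in Ioo a b', orientedTalweg S t < ⊤ := by
  suffices H : ∃ b' ∈ Ioc a b, ∫⁻ t in Ioo a b', orientedTalweg S t ≤ ENNReal.ofReal C by
    obtain ⟨b', hb', h⟩ := H
    refine ⟨b', hb', fun c d hc _ hd => ?_, h, h.trans_lt ENNReal.ofReal_lt_top⟩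
    exact (lintegral_mono_set (Icc_subset_Ioo hc hd)).trans h
  by_cases hex : ∃ t, a < t ∧ (S t).Nonempty
  · obtain ⟨t₁, hat, ht₁⟩ := hex
    have hconn : IsPreconnected (Prod.fst '' sgraph S) :=
      hS.2.1.isPreconnected.image _ continuous_fst.continuousOn
    obtain ⟨x₀, hx₀⟩ := ha.1
    obtain ⟨x₁, hx₁⟩ := ht₁
    have hne : ∀ t ∈ Ioo a (min b t₁), (S t).Nonempty := by
      intro t ht
      have : t ∈ Prod.fst '' sgraph S :=
        hconn.ordConnected.out ⟨(a, x₀), hx₀, rfl⟩ ⟨(t₁, x₁), hx₁, rfl⟩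
          ⟨ht.1.le, ht.2.le.trans (min_le_right _ _)⟩
      obtain ⟨p, hp, rfl⟩ := this
      exact ⟨p.2, hp⟩
    refine ⟨min b t₁, ⟨lt_min hab hat, min_le_left _ _⟩, talweg_bound S hS a _ C hC hne ?_⟩
    intro t r hr
    obtain ⟨k, T, Y, J, hP, hIn, hsum, -⟩ := hr.seq hne
    rw [← hsum]
    exact hbound k T Y hP (fun j i hi =>
      ⟨(hIn j i hi).1, (hIn j i hi).2.trans_le (min_le_left _ _)⟩) J
  · push Not at hex
    refine ⟨b, ⟨hab, le_rfl⟩, ?_⟩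
    have : ∫⁻ t in Ioo a b, orientedTalweg S t = 0 := by
      rw [setLIntegral_congr_fun (g := fun _ => 0) measurableSet_Ioo]
      · simp
      · intro t ht
        simp [orientedTalweg, hex t ht.1]
    rw [this]
    exact bot_le
end

section
/- Let S : ℝ ⇒ ℝⁿ be a smooth sweeping process. Then the functions (t,x) ↦ ‖D*S(t,x)|⁺ and (t,x) ↦ ‖D*S(t,x)‖⁺ are continuous on ∂𝒮, where the image space ℝ ∪ {+∞} = [0,+∞] carries its usual (order) topology. -/
open Set Metric Filter MeasureTheory
open scoped ENNReal RealInnerProductSpace Topology Pointwise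

section Helpers

variable {E : Type*} [NormedAddCommGroup E] [InnerProductSpace ℝ E]

/-- The pairing as a continuous linear map. -/
noncomputable def pinL (v : ℝ × E) : ℝ × E →L[ℝ] ℝ :=
  v.1 • ContinuousLinearMap.fst ℝ ℝ E + (innerSL ℝ v.2).comp (ContinuousLinearMap.snd ℝ ℝ E)

lemma pinL_apply (v h : ℝ × E) : pinL v h = pinner v h := by
  simp [pinL, pinner]

lemma pinner_curve {G : Set (ℝ × E)} {y v h : ℝ × E} (hv : v ∈ frechetNCP G y)
    (γ : ℝ → ℝ × E) (h0 : γ 0 = y) (hγ : HasDerivAt γ h 0)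
    (hG : ∀ᶠ t in 𝓝[>] (0 : ℝ), γ t ∈ G) : pinner v h ≤ 0 := by
  have hslope : Tendsto (fun t : ℝ => t⁻¹ • (γ t - y)) (𝓝[>] 0) (𝓝 h) := by
    have := hγ.tendsto_slope_zero_right
    simpa [h0] using this
  have hc : Tendsto γ (𝓝[>] 0) (𝓝 y) := by
    have := hγ.continuousAt.tendsto
    rw [h0] at this
    exact this.mono_left nhdsWithin_le_nhds
  have key : ∀ ε : ℝ, 0 < ε → pinner v h ≤ ε * ‖h‖ := by
    intro ε hε
    obtain ⟨δ, hδ, H⟩ := hv ε hε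
    have hl : Tendsto (fun t : ℝ => pinL v (t⁻¹ • (γ t - y))) (𝓝[>] 0) (𝓝 (pinL v h)) :=
      ((pinL v).continuous.tendsto h).comp hslope
    have hr : Tendsto (fun t : ℝ => ε * ‖t⁻¹ • (γ t - y)‖) (𝓝[>] 0) (𝓝 (ε * ‖h‖)) :=
      hslope.norm.const_mul ε
    rw [← pinL_apply]
    refine le_of_tendsto_of_tendsto hl hr ?_
    have hb : ∀ᶠ t in 𝓝[>] (0 : ℝ), ‖γ t - y‖ < δ := by
      have := hc.eventually (Metric.ball_mem_nhds y hδ)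
      filter_upwards [this] with t ht
      simpa [dist_eq_norm] using ht
    filter_upwards [hb, hG, self_mem_nhdsWithin] with t h1 h2 h3
    have h3' : 0 < t⁻¹ := inv_pos.mpr h3
    have := H _ h2 h1
    rw [map_smul, norm_smul, pinL_apply, Real.norm_of_nonneg h3'.le, smul_eq_mul]
    calc t⁻¹ * pinner v (γ t - y) ≤ t⁻¹ * (ε * ‖γ t - y‖) := by gcongr
      _ = _ := by ring
  by_contra hcon
  push Not at hcon
  have h1 := key (pinner v h / (2 * (‖h‖ + 1))) (by positivity)
  have h2 : pinner v h / (2 * (‖h‖ + 1)) * ‖h‖ = pinner v h * (‖h‖ / (2 * (‖h‖ + 1))) := by ring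
  have h3 : ‖h‖ / (2 * (‖h‖ + 1)) ≤ 1 / 2 := by
    rw [div_le_div_iff₀ (by positivity) (by norm_num)]
    nlinarith [norm_nonneg h]
  rw [h2] at h1
  nlinarith

lemma pinner_line {G : Set (ℝ × E)} {y v h : ℝ × E} (hv : v ∈ frechetNCP G y)
    (hG : ∀ᶠ t in 𝓝[>] (0 : ℝ), y + t • h ∈ G) : pinner v h ≤ 0 := by
  refine pinner_curve hv (fun t => y + t • h) (by simp) ?_ hG
  simpa using ((hasDerivAt_id (0 : ℝ)).smul_const h).const_add y

variable [FiniteDimensional ℝ E]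
variable {W : Type*} [NormedAddCommGroup W] [InnerProductSpace ℝ W] [FiniteDimensional ℝ W]

/-- first component of the adjoint -/
noncomputable def adjA (L : ℝ × E →L[ℝ] W) (w : W) : ℝ := ⟪w, L (1, 0)⟫

/-- second component of the adjoint -/
noncomputable def adjB (L : ℝ × E →L[ℝ] W) (w : W) : E :=
  ContinuousLinearMap.adjoint (L.comp (ContinuousLinearMap.inr ℝ ℝ E)) w

/-- the adjoint -/
noncomputable def adjP (L : ℝ × E →L[ℝ] W) (w : W) : ℝ × E := (adjA L w, adjB L w)

lemma pinner_adjP (L : ℝ × E →L[ℝ] W) (w : W) (h : ℝ × E) :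
    pinner (adjP L w) h = ⟪w, L h⟫ := by
  have : h = h.1 • ((1 : ℝ), (0 : E)) + (0, h.2) := by ext <;> simp
  conv_rhs => rw [this, map_add, map_smul, inner_add_right, inner_smul_right]
  simp only [pinner, adjP, adjA, adjB, ContinuousLinearMap.adjoint_inner_left]
  simp [mul_comm]

lemma adjP_smul (L : ℝ × E →L[ℝ] W) (s : ℝ) (w : W) : adjP L (s • w) = s • adjP L w := by
  simp [adjP, adjA, adjB, inner_smul_left]

lemma adjA_smul (L : ℝ × E →L[ℝ] W) (s : ℝ) (w : W) : adjA L (s • w) = s * adjA L w := by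
  simp [adjA, inner_smul_left]

lemma adjB_smul (L : ℝ × E →L[ℝ] W) (s : ℝ) (w : W) : adjB L (s • w) = s • adjB L w := by
  simp [adjB]

lemma adjP_zero (L : ℝ × E →L[ℝ] W) : adjP L 0 = 0 := by
  simp [adjP, adjA, adjB]

lemma adjP_inj {L : ℝ × E →L[ℝ] W} (hL : Function.Surjective L) {w : W} (h : adjP L w = 0) :
    w = 0 := by
  obtain ⟨x, hx⟩ := hL w
  have := pinner_adjP L w x
  rw [h, hx] at this
  simpa [pinner, eq_comm] using this

lemma adjA_cont : Continuous (fun p : (ℝ × E →L[ℝ] W) × W => adjA p.1 p.2) := by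
  unfold adjA
  fun_prop

lemma adjB_cont : Continuous (fun p : (ℝ × E →L[ℝ] W) × W => adjB p.1 p.2) := by
  unfold adjB
  have h1 : Continuous (fun p : (ℝ × E →L[ℝ] W) × W =>
      ContinuousLinearMap.adjoint (p.1.comp (ContinuousLinearMap.inr ℝ ℝ E))) :=
    (LinearIsometryEquiv.continuous _).comp (by fun_prop)
  exact h1.clm_apply continuous_snd

lemma adjP_cont : Continuous (fun p : (ℝ × E →L[ℝ] W) × W => adjP p.1 p.2) :=
  adjA_cont.prodMk adjB_cont

/-- A vector annihilating the kernel of a surjective map is in the range of the adjoint. -/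
lemma mem_range_adjP {L : ℝ × E →L[ℝ] W} (hL : Function.Surjective L) {v : ℝ × E}
    (hv : ∀ h, L h = 0 → pinner v h = 0) : ∃ w, adjP L w = v := by
  have hk : LinearMap.ker (L : ℝ × E →ₗ[ℝ] W) ≤ LinearMap.ker (pinL v : ℝ × E →ₗ[ℝ] ℝ) := by
    intro h hh
    have := hv h (by simpa using hh)
    simpa [pinL_apply] using this
  obtain ⟨R, hR⟩ := (L : ℝ × E →ₗ[ℝ] W).exists_rightInverse_of_surjective
    (LinearMap.range_eq_top.mpr hL)
  have hR' : ∀ w, L (R w) = w := fun w => by simpa using LinearMap.congr_fun hR w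
  let φ : W →ₗ[ℝ] ℝ := (pinL v : ℝ × E →ₗ[ℝ] ℝ).comp R
  have hφ : ∀ h, φ (L h) = pinner v h := by
    intro h
    have h1 : pinL v (R (L h) - h) = 0 := by
      rw [pinL_apply]; apply hv; rw [map_sub, hR', sub_self]
    rw [map_sub, sub_eq_zero] at h1
    rw [← pinL_apply, ← h1]; rfl
  let w := (InnerProductSpace.toDual ℝ W).symm (LinearMap.toContinuousLinearMap φ)
  have hw : ∀ x, ⟪w, x⟫ = φ x := by
    intro x; simp [w]
  have hh : ∀ h, pinner (adjP L w) h = pinner v h := by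
    intro h; rw [pinner_adjP, hw, hφ]
  refine ⟨w, Prod.ext ?_ ?_⟩
  · simpa [pinner] using hh (1, 0)
  · refine ext_inner_right ℝ fun x => ?_
    simpa [pinner] using hh (0, x)

lemma frechet_sub_range {G U : Set (ℝ × E)} {f : ℝ × E → W} {L : ℝ × E →L[ℝ] W} {y v : ℝ × E}
    (hU : U ∈ 𝓝 y) (hG : ∀ x ∈ U, f x = f y → x ∈ G)
    (hf : HasStrictFDerivAt f L y) (hL : Function.Surjective L) (hv : v ∈ frechetNCP G y) :
    ∃ w, adjP L w = v := by
  have hr : L.range = ⊤ := LinearMap.range_eq_top.mpr hL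
  have key : ∀ h, L h = 0 → pinner v h ≤ 0 := by
    intro h hh
    let k : L.ker := ⟨h, by simpa using hh⟩
    let γ : ℝ → ℝ × E := fun t => hf.implicitFunction f L hr (f y) (t • k)
    have hk0 : HasDerivAt (fun t : ℝ => t • k) k 0 := by
      simpa using (hasDerivAt_id (0 : ℝ)).smul_const k
    have hγ0 : γ 0 = y := by simp [γ]
    have hγ : HasDerivAt γ h 0 := by
      have h1 := (hf.to_implicitFunction hr).hasFDerivAt
      have h2 : HasFDerivAt (hf.implicitFunction f L hr (f y)) L.ker.subtypeL ((0 : ℝ) • k) := by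
        simpa using h1
      exact h2.comp_hasDerivAt (0 : ℝ) hk0
    refine pinner_curve hv γ hγ0 hγ ?_
    have hc : Tendsto γ (𝓝 0) (𝓝 y) := by
      have := hγ.continuousAt.tendsto
      rwa [hγ0] at this
    have he : ∀ᶠ t in 𝓝 (0 : ℝ), f (γ t) = f y := by
      have ht : Tendsto (fun t : ℝ => (f y, t • k)) (𝓝 0) (𝓝 (f y, 0)) := by
        refine tendsto_const_nhds.prodMk_nhds ?_
        simpa using hk0.continuousAt.tendsto
      exact ht.eventually (hf.map_implicitFunction_eq hr)
    refine Filter.Eventually.filter_mono nhdsWithin_le_nhds ?_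
    filter_upwards [hc.eventually hU, he] with t h1 h2 using hG _ h1 h2
  refine mem_range_adjP hL fun h hh => le_antisymm (key h hh) ?_
  have := key (-h) (by simp [hh])
  rw [← pinL_apply, map_neg, pinL_apply] at this
  linarith

/-- Abstract description of the local situation. -/
lemma range_sub_frechet {G U : Set (ℝ × E)} {f : ℝ × E → W} {L : ℝ × E →L[ℝ] W} {y : ℝ × E}
    {w : W} (hU : U ∈ 𝓝 y) (hf : HasFDerivAt f L y)
    (hG : ∀ x ∈ G ∩ U, ⟪w, f x - f y⟫ ≤ 0) : adjP L w ∈ frechetNCP G y := by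
  intro ε hε
  have h1 := hf.isLittleO.def (c := ε / (‖w‖ + 1)) (by positivity)
  obtain ⟨δ, hδ, H⟩ := Metric.eventually_nhds_iff.mp (h1.and (show ∀ᶠ x in 𝓝 y, x ∈ U from hU))
  refine ⟨δ, hδ, fun x hx hxd => ?_⟩
  obtain ⟨h2, h3⟩ := H (y := x) (by simpa [dist_eq_norm] using hxd)
  rw [pinner_adjP]
  have h4 := hG x ⟨hx, h3⟩
  have h5 : ⟪w, L (x - y)⟫ = ⟪w, f x - f y⟫ - ⟪w, f x - f y - L (x - y)⟫ := by
    rw [inner_sub_right w (f x - f y)]; ring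
  have h6 : -⟪w, f x - f y - L (x - y)⟫ ≤ ‖w‖ * ‖f x - f y - L (x - y)‖ := by
    have := abs_real_inner_le_norm w (f x - f y - L (x - y))
    exact (neg_le_abs _).trans this
  have h7 : ‖w‖ * ‖f x - f y - L (x - y)‖ ≤ ‖w‖ * (ε / (‖w‖ + 1) * ‖x - y‖) := by gcongr
  have h8 : ‖w‖ * (ε / (‖w‖ + 1) * ‖x - y‖) ≤ ε * ‖x - y‖ := by
    have : ‖w‖ * (ε / (‖w‖ + 1) * ‖x - y‖) = (‖w‖ / (‖w‖ + 1)) * (ε * ‖x - y‖) := by ring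
    rw [this]
    have h9 : ‖w‖ / (‖w‖ + 1) ≤ 1 := by
      rw [div_le_one (by positivity)]; linarith
    exact mul_le_of_le_one_left (by positivity) h9
  linarith

/-- Abstract modulus. -/
noncomputable def amod (P : Set W) (α : W → ℝ) (β : W → E) : ℝ≥0∞ :=
  ⨆ (w : W) (_ : w ∈ P) (_ : ‖β w‖ ≤ 1), ENNReal.ofReal (α w)

lemma le_amod {P : Set W} {α : W → ℝ} {β : W → E} {w : W} (hw : w ∈ P) (hb : ‖β w‖ ≤ 1) :
    ENNReal.ofReal (α w) ≤ amod P α β :=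
  le_iSup_of_le w (le_iSup_of_le hw (le_iSup_of_le hb le_rfl))

lemma amod_cont {X : Type*} [TopologicalSpace X] {P : Set W} (hPc : IsClosed P)
    (hPs : ∀ s : ℝ, 0 < s → ∀ w ∈ P, s • w ∈ P)
    (α : X → W → ℝ) (β : X → W → E)
    (hαs : ∀ x (s : ℝ) w, α x (s • w) = s * α x w) (hβs : ∀ x (s : ℝ) w, β x (s • w) = s • β x w)
    (x₀ : X) (hα : ∀ w, ContinuousAt (fun p : X × W => α p.1 p.2) (x₀, w))
    (hβ : ∀ w, ContinuousAt (fun p : X × W => β p.1 p.2) (x₀, w))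
    (hinj : ∀ w, α x₀ w = 0 → β x₀ w = 0 → w = 0) :
    ContinuousAt (fun x => amod P (α x) (β x)) x₀ := by
  have hα' : ∀ w, ContinuousAt (fun x => α x w) x₀ := fun w =>
    (hα w).comp (f := fun x => (x, w)) (by fun_prop)
  have hβ' : ∀ w, ContinuousAt (fun x => β x w) x₀ := fun w =>
    (hβ w).comp (f := fun x => (x, w)) (by fun_prop)
  rw [ContinuousAt, tendsto_order]
  constructor
  · intro c hc
    simp only [amod, lt_iSup_iff] at hc
    obtain ⟨w, hw, hb, hc⟩ := hc
    have hct : c ≠ ⊤ := ne_top_of_lt hc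
    have h1 : c.toReal < α x₀ w := by
      rwa [ENNReal.lt_ofReal_iff_toReal_lt hct] at hc
    have hs : ∀ᶠ s in 𝓝[<] (1 : ℝ), c.toReal < s * α x₀ w := by
      refine Filter.Eventually.filter_mono nhdsWithin_le_nhds ?_
      have : Tendsto (fun s : ℝ => s * α x₀ w) (𝓝 1) (𝓝 (1 * α x₀ w)) :=
        (continuous_id.mul continuous_const).tendsto _
      rw [one_mul] at this
      exact this.eventually (lt_mem_nhds h1)
    have hs2 : ∀ᶠ s in 𝓝[<] (1 : ℝ), 0 < s :=
      Filter.Eventually.filter_mono nhdsWithin_le_nhds (lt_mem_nhds one_pos)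
    obtain ⟨s, ⟨h2, h3⟩, h4⟩ := ((hs.and hs2).and self_mem_nhdsWithin).exists
    have h5 : ‖β x₀ (s • w)‖ < 1 := by
      rw [hβs, norm_smul, Real.norm_of_nonneg h3.le]
      have : s < 1 := h4
      nlinarith [norm_nonneg (β x₀ w)]
    have h6 : c.toReal < α x₀ (s • w) := by rwa [hαs]
    have h7 := (hα' (s • w)).eventually (lt_mem_nhds h6)
    have h8 := (hβ' (s • w)).norm.eventually (gt_mem_nhds h5)
    filter_upwards [h7, h8] with x h9 h10
    refine lt_of_lt_of_le ?_ (le_amod (hPs s h3 w hw) h10.le)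
    rwa [ENNReal.lt_ofReal_iff_toReal_lt hct]
  · intro c hc
    obtain ⟨C, hC1, hC2⟩ := ENNReal.lt_iff_exists_nnreal_btwn.mp hc
    have hCpos : (0 : ℝ) < C := by
      have : (0 : ℝ≥0∞) < C := lt_of_le_of_lt zero_le hC1
      exact_mod_cast this
    have hK : IsCompact (P ∩ sphere (0 : W) 1) := (isCompact_sphere 0 1).inter_left hPc
    have key : ∀ w ∈ P ∩ sphere (0 : W) 1, α x₀ w < C * ‖β x₀ w‖ := by
      rintro w ⟨hwP, hw1⟩
      by_contra hcon
      push Not at hcon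
      have hw0 : w ≠ 0 := by rintro rfl; simp at hw1
      -- find a positive scaling giving value at least `C`
      obtain ⟨s, hs, hsb, hsa⟩ : ∃ s : ℝ, 0 < s ∧ s * ‖β x₀ w‖ ≤ 1 ∧ (C : ℝ) ≤ s * α x₀ w := by
        by_cases hb : β x₀ w = 0
        · have ha : 0 < α x₀ w := by
            rw [hb, norm_zero, mul_zero] at hcon
            exact lt_of_le_of_ne hcon fun h => hw0 (hinj w h.symm hb)
          refine ⟨C / α x₀ w, by positivity, by simp [hb], ?_⟩
          rw [div_mul_cancel₀ _ ha.ne']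
        · have hb' : 0 < ‖β x₀ w‖ := norm_pos_iff.mpr hb
          refine ⟨‖β x₀ w‖⁻¹, by positivity, ?_, ?_⟩
          · rw [inv_mul_cancel₀ hb'.ne']
          · rw [inv_mul_eq_div, le_div_iff₀ hb']; exact hcon
      have h1 : ‖β x₀ (s • w)‖ ≤ 1 := by
        rw [hβs, norm_smul, Real.norm_of_nonneg hs.le]; exact hsb
      have h2 := le_amod (α := α x₀) (hPs s hs w hwP) h1
      rw [hαs] at h2
      have h3 : (C : ℝ≥0∞) ≤ ENNReal.ofReal (s * α x₀ w) := by
        rw [← ENNReal.ofReal_coe_nnreal]; exact ENNReal.ofReal_le_ofReal hsa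
      exact absurd (h3.trans h2) (not_le.mpr hC1)
    have hev : ∀ᶠ x in 𝓝 x₀, ∀ w ∈ P ∩ sphere (0 : W) 1, α x w < C * ‖β x w‖ := by
      refine hK.eventually_forall_of_forall_eventually fun w hw => ?_
      exact (hα w).eventually_lt ((hβ w).norm.const_mul _) (key w hw)
    filter_upwards [hev] with x hx
    refine lt_of_le_of_lt ?_ hC2
    refine iSup_le fun w => iSup_le fun hw => iSup_le fun hb => ?_
    rw [← ENNReal.ofReal_coe_nnreal]
    refine ENNReal.ofReal_le_ofReal ?_
    by_cases hw0 : w = 0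
    · have := hαs x 0 w
      rw [zero_smul, zero_mul] at this
      rw [hw0, this]; exact hCpos.le
    · have hn : 0 < ‖w‖ := norm_pos_iff.mpr hw0
      have hi : 0 < ‖w‖⁻¹ := inv_pos.mpr hn
      have := hx (‖w‖⁻¹ • w) ⟨hPs _ hi w hw, by
        simp [norm_smul, hn.ne']⟩
      rw [hαs, hβs, norm_smul, Real.norm_of_nonneg hi.le] at this
      have h2 : ‖w‖⁻¹ * α x w < ‖w‖⁻¹ * (C * ‖β x w‖) := by linarith
      have h3 := lt_of_mul_lt_mul_left h2 hi.le
      nlinarith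

/-- Local normal form for the Fréchet normal cones. -/
lemma limiting_eq {G V : Set (ℝ × E)} {P : Set W} (hPc : IsClosed P)
    {D : ℝ × E → ℝ × E →L[ℝ] W} {z : ℝ × E} (hV : V ∈ 𝓝 z) (hz : z ∈ G)
    (hD : ContinuousAt D z) (hs : Function.Surjective (D z))
    (h1 : ∀ y ∈ G ∩ V, frechetNCP G y ⊆ adjP (D y) '' P)
    (h2 : adjP (D z) '' P ⊆ frechetNCP G z) : limitingNCP G z = adjP (D z) '' P := by
  apply Subset.antisymm
  · rintro v ⟨zs, vs, hzs, hvs, hz', hv'⟩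
    obtain ⟨N, hN⟩ := eventually_atTop.mp (hz'.eventually hV)
    have hw : ∀ i, ∃ w ∈ P, adjP (D (zs (i + N))) w = vs (i + N) := by
      intro i
      exact h1 _ ⟨hzs _, hN _ (by omega)⟩ (hvs _)
    choose w hwP hw using hw
    have hz2 : Tendsto (fun i => zs (i + N)) atTop (𝓝 z) := hz'.comp (tendsto_add_atTop_nat N)
    have hv2 : Tendsto (fun i => vs (i + N)) atTop (𝓝 v) := hv'.comp (tendsto_add_atTop_nat N)
    have hD2 : Tendsto (fun i => D (zs (i + N))) atTop (𝓝 (D z)) := hD.tendsto.comp hz2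
    -- lower bound
    have hK : IsCompact (sphere (0 : W) 1) := isCompact_sphere 0 1
    have hpos : ∀ w ∈ sphere (0 : W) 1, 0 < ‖adjP (D z) w‖ := by
      intro w hw
      refine norm_pos_iff.mpr fun h => ?_
      rw [adjP_inj hs h] at hw
      simp at hw
    obtain ⟨c, hc, hcl⟩ : ∃ c : ℝ, 0 < c ∧ ∀ w ∈ sphere (0 : W) 1, c < ‖adjP (D z) w‖ := by
      rcases (sphere (0 : W) 1).eq_empty_or_nonempty with he | hne
      · exact ⟨1, one_pos, by simp [he]⟩
      · obtain ⟨w0, hw0, hmin⟩ := hK.exists_isMinOn hne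
          (f := fun w => ‖adjP (D z) w‖)
          ((adjP_cont.comp (continuous_const.prodMk continuous_id)).norm.continuousOn)
        refine ⟨‖adjP (D z) w0‖ / 2, by have := hpos w0 hw0; positivity, fun w hw => ?_⟩
        have := hmin hw
        have h3 := hpos w0 hw0
        simp only [mem_setOf_eq] at this
        linarith
    have hev : ∀ᶠ L in 𝓝 (D z), ∀ w ∈ sphere (0 : W) 1, c < ‖adjP L w‖ := by
      refine hK.eventually_forall_of_forall_eventually fun w hw => ?_
      exact (adjP_cont.norm.tendsto (D z, w)).eventually (lt_mem_nhds (hcl w hw))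
    have hbd : ∀ᶠ i in atTop, w i ∈ closedBall (0 : W) ((‖v‖ + 1) / c) := by
      have h3 : ∀ᶠ i in atTop, ‖vs (i + N)‖ < ‖v‖ + 1 :=
        hv2.norm.eventually (gt_mem_nhds (by linarith))
      filter_upwards [hD2.eventually hev, h3] with i h4 h5
      rw [mem_closedBall_zero_iff, le_div_iff₀ hc]
      by_cases hw0 : w i = 0
      · rw [hw0, norm_zero, zero_mul]; positivity
      · have hn : 0 < ‖w i‖ := norm_pos_iff.mpr hw0
        have hi : 0 < ‖w i‖⁻¹ := inv_pos.mpr hn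
        have h6 := h4 (‖w i‖⁻¹ • w i) (by simp [norm_smul, hn.ne'])
        rw [adjP_smul, hw, norm_smul, Real.norm_of_nonneg hi.le, inv_mul_eq_div,
          lt_div_iff₀ hn] at h6
        linarith
    obtain ⟨w₀, -, φ, hφ, hlim⟩ := (isCompact_closedBall (0 : W) ((‖v‖ + 1) / c)).tendsto_subseq'
      hbd.frequently
    refine ⟨w₀, hPc.mem_of_tendsto hlim (Eventually.of_forall fun i => hwP _), ?_⟩
    have h3 : Tendsto (fun i => adjP (D (zs (φ i + N))) (w (φ i))) atTop (𝓝 (adjP (D z) w₀)) :=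
      (adjP_cont.tendsto (D z, w₀)).comp ((hD2.comp hφ.tendsto_atTop).prodMk_nhds hlim)
    have h4 : Tendsto (fun i => vs (φ i + N)) atTop (𝓝 v) := hv2.comp hφ.tendsto_atTop
    simp only [hw] at h3
    exact tendsto_nhds_unique h3 h4
  · intro v hv
    exact ⟨fun _ => z, fun _ => v, fun _ => hz, fun _ => h2 hv, tendsto_const_nhds,
      tendsto_const_nhds⟩

lemma asym_eq {S : ℝ → Set E} {P : Set W} {L : ℝ × E →L[ℝ] W} {z : ℝ × E}
    (h : limitingNCP (sgraph S) z = adjP L '' P) :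
    asymMod S z.1 z.2 = amod P (adjA L) (adjB L) := by
  apply le_antisymm
  · refine iSup_le fun u => iSup_le fun hu => iSup_le fun a => iSup_le fun ha => ?_
    have ha' : (a, -u) ∈ adjP L '' P := h ▸ ha
    obtain ⟨w, hw, he⟩ := ha'
    obtain ⟨h1, h2⟩ := Prod.ext_iff.mp he
    simp only [adjP] at h1 h2
    rw [← h1]
    exact le_amod hw (by rw [h2, norm_neg]; exact hu)
  · refine iSup_le fun w => iSup_le fun hw => iSup_le fun hb => ?_
    refine le_iSup_of_le (-adjB L w) (le_iSup_of_le (by rwa [norm_neg])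
      (le_iSup_of_le (adjA L w) (le_iSup_of_le ?_ le_rfl)))
    change (adjA L w, - -adjB L w) ∈ limitingNCP (sgraph S) z
    rw [h, neg_neg]
    exact ⟨w, hw, rfl⟩

lemma sym_eq {S : ℝ → Set E} {P : Set W} {L : ℝ × E →L[ℝ] W} {z : ℝ × E}
    (h : limitingNCP (sgraph S) z = adjP L '' P) :
    symMod S z.1 z.2 = max (amod P (adjA L) (adjB L)) (amod P (fun w => -adjA L w) (adjB L)) := by
  have habs : ∀ a : ℝ, ENNReal.ofReal |a| = max (ENNReal.ofReal a) (ENNReal.ofReal (-a)) :=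
    fun a => ENNReal.ofReal_max _ _
  apply le_antisymm
  · refine iSup_le fun u => iSup_le fun hu => iSup_le fun a => iSup_le fun ha => ?_
    have ha' : (a, -u) ∈ adjP L '' P := h ▸ ha
    obtain ⟨w, hw, he⟩ := ha'
    obtain ⟨h1, h2⟩ := Prod.ext_iff.mp he
    simp only [adjP] at h1 h2
    rw [← h1, habs]
    have hb : ‖adjB L w‖ ≤ 1 := by rw [h2, norm_neg]; exact hu
    exact max_le_max (le_amod hw hb) (le_amod (α := fun w => -adjA L w) hw hb)
  · have key : ∀ w ∈ P, ‖adjB L w‖ ≤ 1 → ENNReal.ofReal |adjA L w| ≤ symMod S z.1 z.2 := by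
      intro w hw hb
      refine le_iSup_of_le (-adjB L w) (le_iSup_of_le (by rwa [norm_neg])
        (le_iSup_of_le (adjA L w) (le_iSup_of_le ?_ le_rfl)))
      change (adjA L w, - -adjB L w) ∈ limitingNCP (sgraph S) z
      rw [h, neg_neg]
      exact ⟨w, hw, rfl⟩
    refine max_le ?_ ?_
    · refine iSup_le fun w => iSup_le fun hw => iSup_le fun hb => le_trans ?_ (key w hw hb)
      rw [habs]; exact le_max_left _ _
    · refine iSup_le fun w => iSup_le fun hw => iSup_le fun hb => le_trans ?_ (key w hw hb)
      rw [habs]; exact le_max_right _ _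

/-- Continuity from the local normal form. -/
lemma cont_of_local {S : ℝ → Set E} (hcl : IsClosed (sgraph S)) {V : Set (ℝ × E)} {P : Set W}
    (hPc : IsClosed P) (hPs : ∀ s : ℝ, 0 < s → ∀ w ∈ P, s • w ∈ P)
    {D : ℝ × E → ℝ × E →L[ℝ] W} {z : ℝ × E} (hV : IsOpen V) (hzV : z ∈ V)
    (hD : ContinuousOn D V) (hs : ∀ y ∈ V, Function.Surjective (D y))
    (h1 : ∀ y ∈ sgraph S ∩ V, frechetNCP (sgraph S) y ⊆ adjP (D y) '' P)
    (h2 : ∀ y ∈ frontier (sgraph S) ∩ V, adjP (D y) '' P ⊆ frechetNCP (sgraph S) y)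
    (hz : z ∈ frontier (sgraph S)) :
    ContinuousWithinAt (fun p : ℝ × E => asymMod S p.1 p.2) (frontier (sgraph S)) z ∧
    ContinuousWithinAt (fun p : ℝ × E => symMod S p.1 p.2) (frontier (sgraph S)) z := by
  have hlim : ∀ y ∈ frontier (sgraph S) ∩ V,
      limitingNCP (sgraph S) y = adjP (D y) '' P := fun y hy =>
    limiting_eq hPc (hV.mem_nhds hy.2) (hcl.frontier_subset hy.1)
      (hD.continuousAt (hV.mem_nhds hy.2)) (hs y hy.2) h1 (h2 y hy)
  have hDz : ContinuousAt D z := hD.continuousAt (hV.mem_nhds hzV)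
  have hp : ∀ w : W, ContinuousAt (fun p : (ℝ × E) × W => (D p.1, p.2)) (z, w) := fun w =>
    (ContinuousAt.comp (f := Prod.fst) (x := (z, w)) (g := D) hDz continuousAt_fst).prodMk
      continuousAt_snd
  have hA : ∀ w : W, ContinuousAt (fun p : (ℝ × E) × W => adjA (D p.1) p.2) (z, w) := fun w =>
    (adjA_cont.continuousAt (x := (D z, w))).comp (f := fun p : (ℝ × E) × W => (D p.1, p.2))
      (x := (z, w)) (hp w)
  have hB : ∀ w : W, ContinuousAt (fun p : (ℝ × E) × W => adjB (D p.1) p.2) (z, w) := fun w =>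
    (adjB_cont.continuousAt (x := (D z, w))).comp (f := fun p : (ℝ × E) × W => (D p.1, p.2))
      (x := (z, w)) (hp w)
  have c1 := amod_cont hPc hPs (fun y => adjA (D y)) (fun y => adjB (D y))
    (fun y => adjA_smul _) (fun y => adjB_smul _) z hA hB
    (fun w ha hb => adjP_inj (hs z hzV) (Prod.ext ha hb))
  have c2 := amod_cont hPc hPs (fun y w => -adjA (D y) w) (fun y => adjB (D y))
    (fun y s w => by rw [adjA_smul]; ring) (fun y => adjB_smul _) z (fun w => (hA w).neg) hB
    (fun w ha hb => adjP_inj (hs z hzV) (Prod.ext (neg_eq_zero.mp ha) hb))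
  have hev : ∀ᶠ y in 𝓝[frontier (sgraph S)] z, y ∈ frontier (sgraph S) ∩ V :=
    inter_mem self_mem_nhdsWithin (mem_nhdsWithin_of_mem_nhds (hV.mem_nhds hzV))
  constructor
  · refine c1.continuousWithinAt.congr_of_eventuallyEq ?_ (asym_eq (hlim z ⟨hz, hzV⟩))
    filter_upwards [hev] with y hy using asym_eq (hlim y hy)
  · have c3 : ContinuousAt (fun y => max (amod P (adjA (D y)) (adjB (D y)))
        (amod P (fun w => -adjA (D y) w) (adjB (D y)))) z := Filter.Tendsto.max c1 c2
    refine c3.continuousWithinAt.congr_of_eventuallyEq ?_ (sym_eq (hlim z ⟨hz, hzV⟩))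
    filter_upwards [hev] with y hy using sym_eq (hlim y hy)

/-- Sublevel set case. -/
lemma cont_of_sublevel {S : ℝ → Set E} (hcl : IsClosed (sgraph S)) {V : Set (ℝ × E)}
    {g : ℝ × E → ℝ} {D : ℝ × E → ℝ × E →L[ℝ] ℝ} {z : ℝ × E} (hV : IsOpen V) (hzV : z ∈ V)
    (hD : ContinuousOn D V) (hs : ∀ y ∈ V, Function.Surjective (D y))
    (hg : ∀ y ∈ V, HasStrictFDerivAt g (D y) y)
    (hG : ∀ y ∈ V, y ∈ sgraph S ↔ g y ≤ 0)
    (hF : ∀ y ∈ V, y ∈ frontier (sgraph S) → g y = 0)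
    (hz : z ∈ frontier (sgraph S)) :
    ContinuousWithinAt (fun p : ℝ × E => asymMod S p.1 p.2) (frontier (sgraph S)) z ∧
    ContinuousWithinAt (fun p : ℝ × E => symMod S p.1 p.2) (frontier (sgraph S)) z := by
  refine cont_of_local hcl (P := Ici (0 : ℝ)) isClosed_Ici ?_ hV hzV hD hs ?_ ?_ hz
  · intro s hs w hw
    have hw' : (0 : ℝ) ≤ w := hw
    exact mul_nonneg hs.le hw'
  · rintro y ⟨hyG, hyV⟩ v hv
    have hgy := (hG y hyV).mp hyG
    have hVn := hV.mem_nhds hyV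
    obtain ⟨w, hw⟩ := frechet_sub_range (f := g) hVn
      (fun x hx he => (hG x hx).mpr (he ▸ hgy)) (hg y hyV) (hs y hyV) hv
    refine ⟨w, ?_, hw⟩
    obtain ⟨e, he⟩ := hs y hyV (-1)
    have hline : HasDerivAt (fun t : ℝ => y + t • e) e 0 := by
      simpa using ((hasDerivAt_id (0 : ℝ)).smul_const e).const_add y
    have hcomp : HasDerivAt (fun t : ℝ => g (y + t • e)) (-1) 0 := by
      have h1 : HasFDerivAt g (D y) (y + (0 : ℝ) • e) := by simpa using (hg y hyV).hasFDerivAt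
      have := h1.comp_hasDerivAt (0 : ℝ) hline
      rw [he] at this
      exact this
    have hneg : ∀ᶠ t in 𝓝[>] (0 : ℝ), y + t • e ∈ sgraph S := by
      have h2 := hcomp.tendsto_slope_zero_right
      have h3 := h2.eventually (gt_mem_nhds (show (-1 : ℝ) < 0 by norm_num))
      have h4 : ∀ᶠ t in 𝓝[>] (0 : ℝ), y + t • e ∈ V := by
        refine Filter.Eventually.filter_mono nhdsWithin_le_nhds ?_
        have := hline.continuousAt.tendsto
        simp only [zero_smul, add_zero] at this
        exact this.eventually hVn
      filter_upwards [h3, h4, self_mem_nhdsWithin] with t h5 h6 h7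
      rw [hG _ h6]
      simp only [zero_add, zero_smul, add_zero, smul_eq_mul] at h5
      have h8 : 0 < t⁻¹ := inv_pos.mpr h7
      have : g (y + t • e) - g y < 0 := by
        by_contra hcon
        push Not at hcon
        have := mul_nonneg h8.le hcon
        linarith
      linarith
    have := pinner_line hv hneg
    rw [← hw, pinner_adjP, he] at this
    simp at this
    exact this
  · rintro y ⟨hyF, hyV⟩ v ⟨w, hw, rfl⟩
    have hgy := hF y hyV hyF
    refine range_sub_frechet (f := g) (hV.mem_nhds hyV) (hg y hyV).hasFDerivAt ?_
    rintro x ⟨hxG, hxV⟩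
    have := (hG x hxV).mp hxG
    have hw' : (0 : ℝ) ≤ w := hw
    rw [hgy, sub_zero]
    simp only [RCLike.inner_apply, conj_trivial]
    nlinarith

/-- Local two-sidedness of a regular level set. -/
lemma two_sided {U : Set (ℝ × E)} {g : ℝ × E → ℝ} {L : ℝ × E →L[ℝ] ℝ} {z : ℝ × E}
    (hU : IsOpen U) (hzU : z ∈ U) (hg : HasStrictFDerivAt g L z) (hL : Function.Surjective L)
    (hgz : g z = 0) : ∃ V, IsOpen V ∧ z ∈ V ∧ V ⊆ U ∧ IsPreconnected (V ∩ {y | 0 < g y}) ∧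
      IsPreconnected (V ∩ {y | g y < 0}) := by
  have hr : L.range = ⊤ := LinearMap.range_eq_top.mpr hL
  let φ := hg.implicitToOpenPartialHomeomorph g L hr
  have hφz : φ z = (0, 0) := by
    rw [← hgz]; exact hg.implicitToOpenPartialHomeomorph_self hr
  have hzs : z ∈ φ.source := hg.mem_implicitToOpenPartialHomeomorph_source hr
  have hfst : ∀ x, (φ x).1 = g x := fun x => rfl
  have hT : IsOpen (φ.target ∩ φ.symm ⁻¹' U) := φ.isOpen_inter_preimage_symm hU
  have h0 : ((0 : ℝ), (0 : L.ker)) ∈ φ.target ∩ φ.symm ⁻¹' U := by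
    rw [← hφz]
    exact ⟨φ.map_source hzs, by simpa [φ.left_inv hzs] using hzU⟩
  obtain ⟨ε, hε, hball⟩ := Metric.isOpen_iff.mp hT _ h0
  let B : Set (ℝ × L.ker) := ball (0, 0) ε
  have hBt : B ⊆ φ.target := fun p hp => (hball hp).1
  have hconv : ∀ Q : Set ℝ, Convex ℝ Q → IsPreconnected (φ.symm '' B ∩ {y | g y ∈ Q}) := by
    intro Q hQ
    have he : φ.symm '' B ∩ {y | g y ∈ Q} = φ.symm '' (B ∩ Prod.fst ⁻¹' Q) := by
      ext y
      constructor
      · rintro ⟨⟨p, hp, rfl⟩, hy⟩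
        refine ⟨p, ⟨hp, ?_⟩, rfl⟩
        have := hfst (φ.symm p)
        rw [φ.right_inv (hBt hp)] at this
        simpa [this] using hy
      · rintro ⟨p, ⟨hp, hq⟩, rfl⟩
        refine ⟨⟨p, hp, rfl⟩, ?_⟩
        have := hfst (φ.symm p)
        rw [φ.right_inv (hBt hp)] at this
        simpa [← this] using hq
    rw [he]
    refine IsPreconnected.image ?_ _ (φ.continuousOn_symm.mono fun p hp => hBt hp.1)
    refine Convex.isPreconnected ((convex_ball _ _).inter ?_)
    exact hQ.linear_preimage (LinearMap.fst ℝ ℝ L.ker)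
  refine ⟨φ.symm '' B, ?_, ⟨(0, 0), mem_ball_self hε, ?_⟩, ?_, ?_, ?_⟩
  · exact φ.symm.isOpen_image_of_subset_source isOpen_ball (by simpa using hBt)
  · rw [← hφz, φ.left_inv hzs]
  · rintro _ ⟨p, hp, rfl⟩; exact (hball hp).2
  · exact hconv (Ioi 0) (convex_Ioi 0)
  · exact hconv (Iio 0) (convex_Iio 0)

lemma subset_or_compl {G A : Set (ℝ × E)} (hA : IsPreconnected A)
    (hd : ∀ y ∈ A, y ∉ frontier G) : A ⊆ G ∨ A ⊆ Gᶜ := by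
  by_contra hcon
  push Not at hcon
  obtain ⟨h1, h2⟩ := hcon
  obtain ⟨x, hx, hxG⟩ := not_subset.mp h1
  obtain ⟨y, hy, hyG⟩ := not_subset.mp h2
  have hc : A ⊆ interior G ∪ interior Gᶜ := by
    intro p hp
    by_contra hcon
    rw [mem_union, not_or, interior_compl] at hcon
    exact hd p hp ⟨not_not.mp hcon.2, hcon.1⟩
  have hx' : x ∈ interior Gᶜ := (hc hx).resolve_left fun h => hxG (interior_subset h)
  have hy' : y ∈ interior G := (hc hy).resolve_right fun h => hyG (interior_subset h)
  obtain ⟨p, -, hp1, hp2⟩ := hA _ _ isOpen_interior isOpen_interior hc ⟨y, hy, hy'⟩ ⟨x, hx, hx'⟩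
  exact interior_subset hp2 (interior_subset hp1)

lemma local_data {c : ℕ} {U : Set (ℝ × E)} (hU : IsOpen U) {f : ℝ × E → EuclideanSpace ℝ (Fin c)}
    (hf : ContDiffOn ℝ 1 f U)
    (hs : ∀ y ∈ U, Function.Surjective ⇑(fderivWithin ℝ f U y)) :
    ContinuousOn (fderiv ℝ f) U ∧ (∀ y ∈ U, Function.Surjective (fderiv ℝ f y)) ∧
    (∀ y ∈ U, HasStrictFDerivAt f (fderiv ℝ f y) y) := by
  refine ⟨hf.continuousOn_fderiv_of_isOpen hU le_rfl, fun y hy => ?_, fun y hy => ?_⟩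
  · have := hs y hy
    rwa [fderivWithin_of_isOpen hU hy] at this
  · exact (hf.contDiffAt (hU.mem_nhds hy)).hasStrictFDerivAt one_ne_zero

lemma cont_case_one {S : ℝ → Set E} (hcl : IsClosed (sgraph S)) {c : ℕ}
    (hM : IsC1SubmanifoldCodim c (sgraph S)) {z : ℝ × E} (hz : z ∈ frontier (sgraph S)) :
    ContinuousWithinAt (fun p : ℝ × E => asymMod S p.1 p.2) (frontier (sgraph S)) z ∧
    ContinuousWithinAt (fun p : ℝ × E => symMod S p.1 p.2) (frontier (sgraph S)) z := by
  obtain ⟨U, hU, hzU, f, hf, hs, hMU⟩ := hM z (hcl.frontier_subset hz)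
  obtain ⟨hD, hs', hst⟩ := local_data hU hf hs
  have hG : ∀ y ∈ U, (y ∈ sgraph S ↔ f y = 0) := by
    intro y hy
    have := Set.ext_iff.mp hMU y
    simpa [hy] using this
  refine cont_of_local hcl (P := univ) isClosed_univ (by simp) hU hzU hD hs' ?_ ?_ hz
  · rintro y ⟨hyG, hyU⟩ v hv
    have hfy := (hG y hyU).mp hyG
    obtain ⟨w, hw⟩ := frechet_sub_range (hU.mem_nhds hyU)
      (fun x hx he => (hG x hx).mpr (he.trans hfy)) (hst y hyU) (hs' y hyU) hv
    exact ⟨w, mem_univ _, hw⟩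
  · rintro y ⟨hyF, hyU⟩ v ⟨w, -, rfl⟩
    have hfy := (hG y hyU).mp (hcl.frontier_subset hyF)
    refine range_sub_frechet (hU.mem_nhds hyU) (hst y hyU).hasFDerivAt ?_
    rintro x ⟨hxG, hxU⟩
    rw [(hG x hxU).mp hxG, hfy]
    simp

lemma cont_case_two {S : ℝ → Set E} (hcl : IsClosed (sgraph S))
    (hreg : sgraph S = closure (interior (sgraph S)))
    (hM : IsC1SubmanifoldCodim 1 (frontier (sgraph S))) {z : ℝ × E}
    (hz : z ∈ frontier (sgraph S)) :
    ContinuousWithinAt (fun p : ℝ × E => asymMod S p.1 p.2) (frontier (sgraph S)) z ∧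
    ContinuousWithinAt (fun p : ℝ × E => symMod S p.1 p.2) (frontier (sgraph S)) z := by
  obtain ⟨U, hU, hzU, f, hf, hs, hMU⟩ := hM z hz
  obtain ⟨hD, hs', hst⟩ := local_data hU hf hs
  let π : EuclideanSpace ℝ (Fin 1) →L[ℝ] ℝ := EuclideanSpace.proj (0 : Fin 1)
  let g : ℝ × E → ℝ := fun y => π (f y)
  let D : ℝ × E → ℝ × E →L[ℝ] ℝ := fun y => π.comp (fderiv ℝ f y)
  have hπ : ∀ w, π w = 0 ↔ w = 0 := by
    intro w
    constructor
    · intro h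
      ext i
      rw [Subsingleton.elim i 0]
      simpa [π] using h
    · rintro rfl; simp
  have hgD : ∀ y ∈ U, HasStrictFDerivAt g (D y) y := fun y hy =>
    π.hasStrictFDerivAt.comp y (hst y hy)
  have hDc : ContinuousOn D U := continuousOn_const.clm_comp hD
  have hDs : ∀ y ∈ U, Function.Surjective (D y) := by
    intro y hy r
    obtain ⟨x, hx⟩ := hs' y hy (WithLp.toLp 2 (fun _ => r))
    refine ⟨x, ?_⟩
    simp [D, hx, π]
  have hF : ∀ y ∈ U, (y ∈ frontier (sgraph S) ↔ g y = 0) := by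
    intro y hy
    have := Set.ext_iff.mp hMU y
    simp only [mem_inter_iff, hy, and_true, mem_setOf_eq, true_and] at this
    rw [this]; exact (hπ _).symm
  obtain ⟨V, hV, hzV, hVU, hp, hn⟩ := two_sided hU hzU (hgD z hzU) (hDs z hzU) ((hF z hzU).mp hz)
  have hp' := subset_or_compl (G := sgraph S) hp (by
    rintro y ⟨hyV, hy⟩ hyF
    rw [(hF y (hVU hyV))] at hyF
    exact absurd hyF (ne_of_gt hy))
  have hn' := subset_or_compl (G := sgraph S) hn (by
    rintro y ⟨hyV, hy⟩ hyF
    rw [(hF y (hVU hyV))] at hyF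
    exact absurd hyF (ne_of_lt hy))
  have h0 : ∀ y ∈ V, g y = 0 → y ∈ sgraph S := fun y hy h =>
    hcl.frontier_subset ((hF y (hVU hy)).mpr h)
  rcases hp' with hp' | hp' <;> rcases hn' with hn' | hn'
  · exfalso
    have : V ⊆ sgraph S := by
      intro y hy
      rcases lt_trichotomy (g y) 0 with h | h | h
      · exact hn' ⟨hy, h⟩
      · exact h0 y hy h
      · exact hp' ⟨hy, h⟩
    exact hz.2 (mem_interior.mpr ⟨V, this, hV, hzV⟩)
  · -- the graph is locally the superlevel set
    refine cont_of_sublevel (g := fun y => -g y) (D := fun y => -D y) hcl hV hzV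
      (hDc.mono hVU).neg (fun y hy r => ?_) (fun y hy => (hgD y (hVU hy)).neg) ?_ ?_ hz
    · obtain ⟨x, hx⟩ := hDs y (hVU hy) (-r)
      exact ⟨x, by simp [hx]⟩
    · intro y hy
      constructor
      · intro h
        by_contra hcon
        exact hn' ⟨hy, by simpa using hcon⟩ h
      · intro h
        have h' : 0 ≤ g y := by simpa using h
        rcases h'.lt_or_eq with h | h
        · exact hp' ⟨hy, h⟩
        · exact h0 y hy h.symm
    · intro y hy h
      simpa using (hF y (hVU hy)).mp h
  · refine cont_of_sublevel (g := g) (D := D) hcl hV hzV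
      (hDc.mono hVU) (fun y hy => hDs y (hVU hy)) (fun y hy => hgD y (hVU hy)) ?_ ?_ hz
    · intro y hy
      constructor
      · intro h
        by_contra hcon
        exact hp' ⟨hy, by simpa using hcon⟩ h
      · intro h
        rcases h.lt_or_eq with h | h
        · exact hn' ⟨hy, h⟩
        · exact h0 y hy h
    · intro y hy h
      exact (hF y (hVU hy)).mp h
  · exfalso
    have hzc : z ∈ closure (interior (sgraph S)) := hreg ▸ hcl.frontier_subset hz
    obtain ⟨y, hyV, hyi⟩ := mem_closure_iff.mp hzc V hV hzV
    have hyG := interior_subset hyi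
    rcases lt_trichotomy (g y) 0 with h | h | h
    · exact hn' ⟨hyV, h⟩ hyG
    · exact ((hF y (hVU hyV)).mpr h).2 hyi
    · exact hp' ⟨hyV, h⟩ hyG

end Helpers

/-- Lemma: continuity of the (oriented) modulus on `∂𝒮`: for a smooth
sweeping process, `(t,x) ↦ ‖D*S(t,x)|⁺` and `(t,x) ↦ ‖D*S(t,x)‖⁺` are continuous on
`∂𝒮` with values in `[0,+∞]`. -/
theorem statement10 {E : Type*} [NormedAddCommGroup E] [InnerProductSpace ℝ E]
    [FiniteDimensional ℝ E] (S : ℝ → Set E) (hS : SmoothSweepingProcess S) :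
    ContinuousOn (fun p : ℝ × E => asymMod S p.1 p.2) (frontier (sgraph S)) ∧
    ContinuousOn (fun p : ℝ × E => symMod S p.1 p.2) (frontier (sgraph S)) := by
  obtain ⟨hcl, -, h⟩ := hS
  rcases h with ⟨c, -, hM⟩ | ⟨hreg, hM⟩
  · exact ⟨fun z hz => (cont_case_one hcl hM hz).1, fun z hz => (cont_case_one hcl hM hz).2⟩
  · exact ⟨fun z hz => (cont_case_two hcl hreg hM hz).1,
      fun z hz => (cont_case_two hcl hreg hM hz).2⟩
end
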